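/- Let 0 ≤ η ≤ 1. For every ε > 0 there exists K₀ such that for all integers K ≥ K₀ and all integers M with 1 ≤ M < 2^{ηK}, the length L(M·3^K) of the longest block of consecutive equal binary digits (0s or 1s) in the binary expansion of M·3^K satisfies L(M·3^K) ≤ η·K + ε·K. -/

import Mathlib

/-- `runLength M` is the length of the longest block of consecutive equal binary digits
(`0`s or `1`s) occurring in the binary expansion of `M`. -/
noncomputable def runLength (M : ℕ) : ℕ :=
  sSup {l | ∃ a, a + l ≤ (Nat.digits 2 M).length ∧ ∀ j < l, M.testBit (a + j) = M.testBit a}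

set_option linter.all false

namespace Rid
open MvPolynomial

section basic
variable {σ : Type*} [Fintype σ] {R : Type*} [CommRing R]

/-- multi-binomial coefficient -/
noncomputable def bin (e I : σ →₀ ℕ) : ℕ := ∏ i, (e i).choose (I i)

/-- multivariate Hasse derivative -/
noncomputable def hd (I : σ →₀ ℕ) : MvPolynomial σ R →ₗ[R] MvPolynomial σ R :=
  (basisMonomials σ R).constr R (fun e => monomial (e - I) (bin e I : R))

lemma bin_eq_zero {e I : σ →₀ ℕ} (h : ¬ I ≤ e) : bin e I = 0 := by
  rw [Finsupp.le_def] at h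
  push Not at h
  obtain ⟨i, hi⟩ := h
  exact Finset.prod_eq_zero (Finset.mem_univ i) (Nat.choose_eq_zero_of_lt hi)

lemma hd_monomial (I e : σ →₀ ℕ) (c : R) :
    hd I (monomial e c) = monomial (e - I) (bin e I * c : R) := by
  have h1 : (monomial e c : MvPolynomial σ R) = c • (basisMonomials σ R e) := by
    simp [smul_monomial]
  rw [h1, map_smul, hd, Module.Basis.constr_basis, smul_monomial, smul_eq_mul, mul_comm]

lemma coeff_hd (I e : σ →₀ ℕ) (p : MvPolynomial σ R) :
    coeff e (hd I p) = bin (e + I) I * coeff (e + I) p := by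
  classical
  induction p using MvPolynomial.induction_on' with
  | monomial J c =>
    rw [hd_monomial, coeff_monomial, coeff_monomial]
    by_cases hIJ : I ≤ J
    · have : J - I = e ↔ J = e + I := tsub_eq_iff_eq_add_of_le hIJ
      by_cases h : J = e + I
      · rw [if_pos (this.2 h), if_pos h, h]
      · rw [if_neg (fun h' => h (this.1 h')), if_neg h, mul_zero]
    · have h2 : J ≠ e + I := fun h => hIJ (h ▸ le_add_self)
      rw [bin_eq_zero hIJ, if_neg h2]; simp
  | add p q hp hq => rw [map_add, coeff_add, coeff_add, hp, hq, mul_add]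

lemma bin_self (I : σ →₀ ℕ) : bin I I = 1 := by simp [bin]

lemma bin_single [DecidableEq σ] (J I : σ →₀ ℕ) (i : σ) :
    bin (J + Finsupp.single i 1) (I + Finsupp.single i 1) =
      bin J I + bin J (I + Finsupp.single i 1) := by
  unfold bin
  rw [← Finset.mul_prod_erase _ _ (Finset.mem_univ i), ← Finset.mul_prod_erase _ _ (Finset.mem_univ i),
    ← Finset.mul_prod_erase _ _ (Finset.mem_univ i)]
  have h : ∀ A : σ →₀ ℕ, ∀ j ∈ Finset.univ.erase i, (A + Finsupp.single i 1 : σ →₀ ℕ) j = A j := by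
    intro A j hj
    have : j ≠ i := Finset.ne_of_mem_erase hj
    simp [Finsupp.single_apply, this.symm]
  rw [Finset.prod_congr rfl (fun j hj => by rw [h J j hj, h I j hj]),
    Finset.prod_congr (g := fun j => (J j).choose (I j)) (s₂ := Finset.univ.erase i) rfl
      (f := fun x => (J x).choose ((I + Finsupp.single i 1 : σ →₀ ℕ) x))
      (fun j hj => by rw [h I j hj])]
  simp [Nat.choose_succ_succ, add_mul]

lemma bin_single_zero [DecidableEq σ] (J I : σ →₀ ℕ) (i : σ) (hi : I i = 0) :
    bin (J + Finsupp.single i 1) I = bin J I := by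
  unfold bin
  refine Finset.prod_congr rfl fun j _ => ?_
  by_cases h : j = i
  · subst h; simp [hi]
  · simp [Finsupp.single_apply, Ne.symm h]

lemma hd_X_mul_zero [DecidableEq σ] (I : σ →₀ ℕ) (i : σ) (hi : I i = 0) (p : MvPolynomial σ R) :
    hd I (X i * p) = X i * hd I p := by
  induction p using MvPolynomial.induction_on' with
  | monomial J c =>
    rw [hd_monomial, X, monomial_mul, monomial_mul, hd_monomial, add_comm, bin_single_zero _ _ _ hi]
    by_cases hIJ : I ≤ J
    · rw [add_comm, add_comm _ (J - I), tsub_add_eq_add_tsub hIJ, add_comm J]; simp [add_comm]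
    · rw [bin_eq_zero hIJ]; simp
  | add p q hp hq => rw [mul_add, map_add, map_add, hp, hq, mul_add]

lemma hd_X_mul_succ [DecidableEq σ] (I : σ →₀ ℕ) (i : σ) (p : MvPolynomial σ R) :
    hd (I + Finsupp.single i 1) (X i * p) = X i * hd (I + Finsupp.single i 1) p + hd I p := by
  induction p using MvPolynomial.induction_on' with
  | monomial J c =>
    rw [hd_monomial, X, monomial_mul, monomial_mul, hd_monomial, add_comm _ J, bin_single, hd_monomial]
    rw [add_tsub_add_eq_tsub_right]
    by_cases hIJ : I + Finsupp.single i 1 ≤ J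
    · have : Finsupp.single i 1 + (J - (I + Finsupp.single i 1)) = J - I := by
        ext j
        have := hIJ j
        simp only [Finsupp.add_apply, Finsupp.tsub_apply] at *
        omega
      rw [this, ← map_add]
      congr 1; push_cast; ring
    · rw [bin_eq_zero hIJ]; simp
  | add p q hp hq => rw [mul_add, map_add, map_add, hp, hq, mul_add, map_add]; ring

/-- translation of the variables -/
noncomputable def shift (ξ : σ → R) : MvPolynomial σ R →ₐ[R] MvPolynomial σ R :=
  aeval (fun i => X i + C (ξ i))

lemma hd_C_mul (I : σ →₀ ℕ) (c : R) (p : MvPolynomial σ R) : hd I (C c * p) = C c * hd I p := by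
  rw [← smul_eq_C_mul, map_smul, smul_eq_C_mul]

lemma hd_shift (ξ : σ → R) (I : σ →₀ ℕ) (p : MvPolynomial σ R) :
    hd I (shift ξ p) = shift ξ (hd I p) := by
  classical
  induction p using MvPolynomial.induction_on generalizing I with
  | C a =>
    have hC : shift ξ (C a) = C a := by simp [shift]
    rw [hC]
    by_cases hI : I = 0
    · subst hI
      have : (C a : MvPolynomial σ R) = monomial 0 a := rfl
      rw [this, hd_monomial]; simp [shift, bin]
    · have : (C a : MvPolynomial σ R) = monomial 0 a := rfl
      rw [this, hd_monomial, bin_eq_zero (by simpa using hI)]; simp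
  | add p q hp hq => simp only [map_add, hp, hq]
  | mul_X p i ih =>
    have hs : ∀ q, shift ξ (X i * q) = X i * shift ξ q + C (ξ i) * shift ξ q := by
      intro q; simp [shift, add_mul]
    rw [mul_comm p, hs, map_add, hd_C_mul]
    by_cases hi : I i = 0
    · rw [hd_X_mul_zero _ _ hi, hd_X_mul_zero _ _ hi, hs, ih]
    · obtain ⟨I', rfl⟩ : ∃ I', I = I' + Finsupp.single i 1 := by
        refine ⟨I - Finsupp.single i 1, ?_⟩
        rw [tsub_add_cancel_of_le]
        simpa using Nat.one_le_iff_ne_zero.2 hi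
      rw [hd_X_mul_succ, hd_X_mul_succ, map_add, hs, ih, ih]; ring

lemma coeff_shift (ξ : σ → R) (I : σ →₀ ℕ) (p : MvPolynomial σ R) :
    coeff I (shift ξ p) = eval ξ (hd I p) := by
  have h1 : coeff I (shift ξ p) = coeff 0 (hd I (shift ξ p)) := by
    rw [coeff_hd, zero_add, bin_self]; simp
  have h2 : ∀ q : MvPolynomial σ R, coeff 0 (shift ξ q) = eval ξ q := by
    intro q
    rw [← constantCoeff_eq]
    have : (constantCoeff.comp (shift ξ : MvPolynomial σ R →ₐ[R] MvPolynomial σ R).toRingHom)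
        = eval ξ := by
      ext i <;> simp [shift]
    exact congrArg (fun f => f q) this
  rw [h1, hd_shift, h2]

lemma shift_shift (a b : σ → R) (p : MvPolynomial σ R) :
    shift a (shift b p) = shift (a + b) p := by
  have : (shift a).comp (shift b) = shift (a + b) := by
    ext i : 1
    simp [shift, add_assoc]
  exact congrArg (fun f => f p) this

lemma shift_zero (p : MvPolynomial σ R) : shift 0 p = p := by
  have : shift (0 : σ → R) = AlgHom.id R _ := by
    ext i : 1
    simp [shift]
  exact congrArg (fun f => f p) this

lemma shift_ne_zero (a : σ → R) {p : MvPolynomial σ R} (hp : p ≠ 0) : shift a p ≠ 0 := by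
  intro h
  apply hp
  have := shift_shift (-a) a p
  rw [h, neg_add_cancel, shift_zero, map_zero] at this
  exact this.symm

lemma map_hd {S : Type*} [CommRing S] (f : R →+* S) (I : σ →₀ ℕ) (p : MvPolynomial σ R) :
    MvPolynomial.map f (hd I p) = hd I (MvPolynomial.map f p) := by
  ext e; simp [coeff_hd, coeff_map]

lemma degreeOf_hd_le (I : σ →₀ ℕ) (p : MvPolynomial σ R) (i : σ) :
    degreeOf i (hd I p) ≤ degreeOf i p := by
  rw [degreeOf_le_iff]
  intro e he
  rw [mem_support_iff, coeff_hd] at he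
  have : e + I ∈ p.support := by
    rw [mem_support_iff]; intro h; exact he (by rw [h, mul_zero])
  have := monomial_le_degreeOf i this
  simp at this; omega

/-- all monomials have weight at least `s` -/
def Idx (w : σ → ℝ) (p : MvPolynomial σ R) (s : ℝ) : Prop :=
  ∀ e ∈ p.support, s ≤ ∑ i, (e i : ℝ) * w i

lemma Idx.mono {w : σ → ℝ} {p : MvPolynomial σ R} {s t : ℝ} (h : Idx w p s) (hst : t ≤ s) :
    Idx w p t := fun e he => hst.trans (h e he)

lemma Idx.mul {w : σ → ℝ} {p q : MvPolynomial σ R} {s t : ℝ} (hp : Idx w p s) (hq : Idx w q t) :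
    Idx w (p * q) (s + t) := by
  classical
  intro e he
  obtain ⟨a, ha, b, hb, rfl⟩ := Finset.mem_add.1 (support_mul p q he)
  have := hp a ha
  have := hq b hb
  simp only [Finsupp.add_apply, Nat.cast_add, add_mul, Finset.sum_add_distrib]
  linarith

lemma Idx.sum {ι : Type*} {w : σ → ℝ} {f : ι → MvPolynomial σ R} {s : ℝ} (S : Finset ι)
    (h : ∀ i ∈ S, Idx w (f i) s) : Idx w (∑ i ∈ S, f i) s := by
  classical
  intro e he
  obtain ⟨i, hi, hie⟩ := Finset.mem_biUnion.1 (support_sum he)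
  exact h i hi e hie

lemma Idx.prod {ι : Type*} {w : σ → ℝ} {f : ι → MvPolynomial σ R} {s : ι → ℝ} (S : Finset ι)
    (h : ∀ i ∈ S, Idx w (f i) (s i)) : Idx w (∏ i ∈ S, f i) (∑ i ∈ S, s i) := by
  classical
  induction S using Finset.induction_on with
  | empty =>
    intro e he
    have : (1 : MvPolynomial σ R) = monomial 0 1 := rfl
    simp only [Finset.prod_empty, Finset.sum_empty] at *
    rw [this, mem_support_iff, coeff_monomial] at he
    have : e = 0 := by
      by_contra h0
      exact he (if_neg (Ne.symm h0))
    subst this; simp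
  | insert a S ha ih =>
    rw [Finset.prod_insert ha, Finset.sum_insert ha]
    exact (h a (Finset.mem_insert_self _ _)).mul (ih fun i hi => h i (Finset.mem_insert_of_mem hi))

lemma Idx.hd {w : σ → ℝ} {p : MvPolynomial σ R} {s : ℝ} (hp : Idx w p s) (I : σ →₀ ℕ) :
    Idx w (hd I p) (s - ∑ i, (I i : ℝ) * w i) := by
  intro e he
  rw [mem_support_iff, coeff_hd] at he
  have : e + I ∈ p.support := by
    rw [mem_support_iff]; intro h; exact he (by rw [h, mul_zero])
  have := hp _ this
  simp only [Finsupp.add_apply, Nat.cast_add, add_mul, Finset.sum_add_distrib] at this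
  linarith

lemma Idx.nonneg {w : σ → ℝ} (hw : ∀ i, 0 ≤ w i) (p : MvPolynomial σ R) : Idx w p 0 := by
  intro e _
  exact Finset.sum_nonneg fun i _ => mul_nonneg (Nat.cast_nonneg _) (hw i)

/-- sum of absolute values of the coefficients -/
noncomputable def l1 (p : MvPolynomial σ ℤ) : ℕ := ∑ e ∈ p.support, (coeff e p).natAbs

lemma l1_eq (p : MvPolynomial σ ℤ) (S : Finset (σ →₀ ℕ)) (h : p.support ⊆ S) :
    l1 p = ∑ e ∈ S, (coeff e p).natAbs := by
  unfold l1
  refine Finset.sum_subset h ?_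
  intro x _ hx
  simpa using hx

lemma coeff_le_l1 (p : MvPolynomial σ ℤ) (e : σ →₀ ℕ) : (coeff e p).natAbs ≤ l1 p := by
  by_cases he : e ∈ p.support
  · exact Finset.single_le_sum (f := fun e => (coeff e p).natAbs) (fun _ _ => Nat.zero_le _) he
  · rw [notMem_support_iff] at he; simp [he]

lemma l1_add_le (p q : MvPolynomial σ ℤ) : l1 (p + q) ≤ l1 p + l1 q := by
  classical
  rw [l1_eq (p + q) (p.support ∪ q.support) support_add,
    l1_eq p (p.support ∪ q.support) Finset.subset_union_left,
    l1_eq q (p.support ∪ q.support) Finset.subset_union_right, ← Finset.sum_add_distrib]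
  exact Finset.sum_le_sum fun e _ => by rw [coeff_add]; exact Int.natAbs_add_le _ _

lemma l1_zero : l1 (0 : MvPolynomial σ ℤ) = 0 := by simp [l1]

lemma l1_sum_le {ι : Type*} (S : Finset ι) (f : ι → MvPolynomial σ ℤ) :
    l1 (∑ i ∈ S, f i) ≤ ∑ i ∈ S, l1 (f i) := by
  classical
  induction S using Finset.induction_on with
  | empty => simp [l1_zero]
  | insert a S ha ih =>
    rw [Finset.sum_insert ha, Finset.sum_insert ha]
    exact (l1_add_le _ _).trans (by omega)

lemma l1_monomial_mul_le (e : σ →₀ ℕ) (c : ℤ) (q : MvPolynomial σ ℤ) :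
    l1 (monomial e c * q) ≤ c.natAbs * l1 q := by
  classical
  have hs : (monomial e c * q).support ⊆ q.support.image (fun m => e + m) := by
    intro m hm
    have := support_mul _ _ hm
    obtain ⟨a, ha, b, hb, rfl⟩ := Finset.mem_add.1 this
    have := support_monomial_subset ha
    rw [Finset.mem_singleton] at this
    subst this
    exact Finset.mem_image_of_mem _ hb
  rw [l1_eq _ _ hs, Finset.sum_image (by intro a _ b _ h; exact add_left_cancel h)]
  unfold l1
  rw [Finset.mul_sum]
  refine Finset.sum_le_sum fun m _ => ?_
  rw [coeff_monomial_mul, Int.natAbs_mul]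

lemma l1_mul_le (p q : MvPolynomial σ ℤ) : l1 (p * q) ≤ l1 p * l1 q := by
  conv_lhs => rw [p.as_sum, Finset.sum_mul]
  refine (l1_sum_le _ _).trans ?_
  rw [l1, Finset.sum_mul]
  exact Finset.sum_le_sum fun e _ => l1_monomial_mul_le _ _ _

lemma l1_one : l1 (1 : MvPolynomial σ ℤ) ≤ 1 := by
  classical
  have h1 : (1 : MvPolynomial σ ℤ) = monomial 0 1 := rfl
  rw [h1, l1_eq _ {0} support_monomial_subset]; simp

lemma l1_prod_le {ι : Type*} (S : Finset ι) (f : ι → MvPolynomial σ ℤ) :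
    l1 (∏ i ∈ S, f i) ≤ ∏ i ∈ S, l1 (f i) := by
  classical
  induction S using Finset.induction_on with
  | empty => simpa using l1_one
  | insert a S ha ih =>
    rw [Finset.prod_insert ha, Finset.prod_insert ha]
    exact (l1_mul_le _ _).trans (Nat.mul_le_mul_left _ ih)

lemma l1_neg (p : MvPolynomial σ ℤ) : l1 (-p) = l1 p := by
  simp [l1]

lemma bin_le {e I d : σ →₀ ℕ} (h : ∀ i, e i ≤ d i) : bin e I ≤ 2 ^ (∑ i, d i) := by
  rw [← Finset.prod_pow_eq_pow_sum]
  refine Finset.prod_le_prod' fun i _ => (Nat.choose_le_two_pow _ _).trans ?_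
  exact Nat.pow_le_pow_right (by norm_num) (h i)

lemma l1_hd_le (I : σ →₀ ℕ) (p : MvPolynomial σ ℤ) :
    l1 (hd I p) ≤ 2 ^ (∑ i, degreeOf i p) * l1 p := by
  classical
  have hs : (hd I p).support ⊆ p.support.image (fun m => m - I) := by
    intro e he
    rw [mem_support_iff, coeff_hd] at he
    refine Finset.mem_image.2 ⟨e + I, ?_, by simp⟩
    rw [mem_support_iff]; intro h; exact he (by rw [h, mul_zero])
  conv_lhs => rw [p.as_sum, map_sum]
  refine (l1_sum_le _ _).trans ?_
  rw [l1, Finset.mul_sum]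
  refine Finset.sum_le_sum fun e he => ?_
  rw [hd_monomial, l1_eq _ _ support_monomial_subset]
  simp only [Finset.sum_singleton, coeff_monomial, if_true, Int.natAbs_mul, Int.natAbs_natCast]
  refine Nat.mul_le_mul_right _ ?_
  exact bin_le (d := Finsupp.equivFunOnFinite.symm fun i => degreeOf i p)
    (fun i => monomial_le_degreeOf i he)

lemma l1_det_le {k : ℕ} (M : Matrix (Fin k) (Fin k) (MvPolynomial σ ℤ)) (B : ℕ)
    (h : ∀ a b, l1 (M a b) ≤ B) : l1 M.det ≤ k.factorial * B ^ k := by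
  classical
  rw [Matrix.det_apply]
  refine (l1_sum_le _ _).trans ?_
  have : ∀ τ ∈ (Finset.univ : Finset (Equiv.Perm (Fin k))),
      l1 (Equiv.Perm.sign τ • ∏ i, M (τ i) i) ≤ B ^ k := by
    intro τ _
    have h1 : l1 (∏ i, M (τ i) i) ≤ B ^ k := by
      refine (l1_prod_le _ _).trans ?_
      refine (Finset.prod_le_prod' (fun i _ => h (τ i) i)).trans ?_
      simp
    rcases Int.units_eq_one_or (Equiv.Perm.sign τ) with h2 | h2 <;> rw [h2]
    · simpa using h1
    · simpa [l1_neg] using h1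
  refine (Finset.sum_le_sum this).trans ?_
  simp [Finset.card_univ, Fintype.card_perm]

lemma degreeOf_det_le {k : ℕ} (M : Matrix (Fin k) (Fin k) (MvPolynomial σ R)) (i : σ) (d : ℕ)
    (h : ∀ a b, degreeOf i (M a b) ≤ d) : degreeOf i M.det ≤ k * d := by
  classical
  rw [Matrix.det_apply]
  refine (degreeOf_sum_le _ _ _).trans ?_
  refine Finset.sup_le fun τ _ => ?_
  have h1 : degreeOf i (∏ j, M (τ j) j) ≤ k * d := by
    refine (degreeOf_prod_le _ _ _).trans ?_
    refine (Finset.sum_le_sum (fun j _ => h (τ j) j)).trans ?_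
    simp
  rcases Int.units_eq_one_or (Equiv.Perm.sign τ) with h2 | h2 <;> rw [h2]
  · simpa using h1
  · simpa [degreeOf_eq_sup] using h1

lemma idx_det {k : ℕ} {w : σ → ℝ} (M : Matrix (Fin k) (Fin k) (MvPolynomial σ R)) (s : Fin k → ℝ)
    (h : ∀ a b, Idx w (M a b) (s b)) : Idx w M.det (∑ b, s b) := by
  classical
  rw [Matrix.det_apply]
  refine Idx.sum _ fun τ _ => ?_
  have h1 : Idx w (∏ j, M (τ j) j) (∑ b, s b) := Idx.prod _ fun j _ => h _ _
  rcases Int.units_eq_one_or (Equiv.Perm.sign τ) with h2 | h2 <;> rw [h2]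
  · simpa using h1
  · simpa [Idx] using h1

end basic
end Rid

namespace Rid
open MvPolynomial

section gw
variable {σ : Type*} [Fintype σ]

lemma mul_bin [DecidableEq σ] (J I : σ →₀ ℕ) (i : σ) :
    ((J i : ℕ) : ℚ) * bin J I = (I i + 1) * bin J (I + Finsupp.single i 1) + I i * bin J I := by
  have h1 : (bin J I : ℚ) = (J i).choose (I i) * ∏ j ∈ Finset.univ.erase i, ((J j).choose (I j) : ℚ) := by
    unfold bin
    push_cast
    rw [Finset.mul_prod_erase _ (fun j => ((J j).choose (I j) : ℚ)) (Finset.mem_univ i)]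
  have h2 : (bin J (I + Finsupp.single i 1) : ℚ) =
      (J i).choose (I i + 1) * ∏ j ∈ Finset.univ.erase i, ((J j).choose (I j) : ℚ) := by
    unfold bin
    push_cast
    rw [← Finset.mul_prod_erase _ _ (Finset.mem_univ i)]
    congr 1
    · simp
    · refine Finset.prod_congr rfl fun j hj => ?_
      have : j ≠ i := Finset.ne_of_mem_erase hj
      simp [this.symm]
  have h3 : ((J i : ℕ) : ℚ) * (J i).choose (I i) =
      (I i + 1) * (J i).choose (I i + 1) + I i * (J i).choose (I i) := by
    by_cases hle : I i ≤ J i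
    · have := Nat.choose_succ_right_eq (J i) (I i)
      have h4 : (((J i).choose (I i + 1) : ℕ) : ℚ) * (I i + 1) = (J i).choose (I i) * ((J i : ℚ) - I i) := by
        rw [← Nat.cast_sub hle]; exact_mod_cast this
      linarith
    · push Not at hle
      rw [Nat.choose_eq_zero_of_lt hle, Nat.choose_eq_zero_of_lt (by omega)]; simp
  rw [h1, h2]
  linear_combination (∏ j ∈ Finset.univ.erase i, ((J j).choose (I j) : ℚ)) * h3

/-- span of the multi-binomial functions of degree at most `d` -/
noncomputable def bspan {k : ℕ} (J : Fin k → σ →₀ ℕ) (d : ℕ) : Submodule ℚ (Fin k → ℚ) :=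
  Submodule.span ℚ {v | ∃ I : σ →₀ ℕ, ∑ i, I i ≤ d ∧ v = fun b => (bin (J b) I : ℚ)}

lemma bspan_mul {k : ℕ} (J : Fin k → σ →₀ ℕ) (d : ℕ) (i : σ) (c : ℚ) (v : Fin k → ℚ)
    (hv : v ∈ bspan J d) : (fun b => ((J b i : ℚ) - c) * v b) ∈ bspan J (d + 1) := by
  classical
  unfold bspan at hv
  induction hv using Submodule.span_induction with
  | mem v hv =>
    obtain ⟨I, hI, rfl⟩ := hv
    have : (fun b => ((J b i : ℚ) - c) * (bin (J b) I : ℚ)) =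
        ((I i : ℚ) + 1) • (fun b => (bin (J b) (I + Finsupp.single i 1) : ℚ)) +
        ((I i : ℚ) - c) • (fun b => (bin (J b) I : ℚ)) := by
      funext b
      simp only [Pi.add_apply, Pi.smul_apply, smul_eq_mul]
      linear_combination mul_bin (J b) I i
    rw [this]
    refine add_mem (Submodule.smul_mem _ _ (Submodule.subset_span ⟨_, ?_, rfl⟩))
      (Submodule.smul_mem _ _ (Submodule.subset_span ⟨_, by omega, rfl⟩))
    simp [Finset.sum_add_distrib, Finsupp.single_apply]
    exact hI
  | zero => simp; exact zero_mem _
  | add v w _ _ hv hw =>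
    convert add_mem hv hw using 1
    funext b; simp [mul_add]
  | smul a v _ hv =>
    convert Submodule.smul_mem _ a hv using 1
    funext b; simp; ring

lemma bspan_prod {k : ℕ} (J : Fin k → σ →₀ ℕ) (S : Finset (Fin k)) (i : Fin k → σ) (c : Fin k → ℚ) :
    (fun b => ∏ s ∈ S, ((J b (i s) : ℚ) - c s)) ∈ bspan J S.card := by
  classical
  induction S using Finset.induction_on with
  | empty =>
    refine Submodule.subset_span ⟨0, by simp, ?_⟩
    funext b; simp [bin]
  | insert a S ha ih =>
    simp only [Finset.prod_insert ha, Finset.card_insert_of_notMem ha]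
    exact bspan_mul J _ (i a) (c a) _ ih

lemma exists_bin_det {k : ℕ} (J : Fin k → σ →₀ ℕ) (hJ : Function.Injective J) :
    ∃ I : Fin k → σ →₀ ℕ, (∀ a, ∑ i, I a i < k) ∧
      (Matrix.of fun a b => (bin (J b) (I a) : ℚ)).det ≠ 0 := by
  classical
  rcases Nat.eq_zero_or_pos k with rfl | hk
  · exact ⟨fun a => 0, fun a => a.elim0, by simp⟩
  rcases isEmpty_or_nonempty σ with hσ | hσ
  · have hsub : ∀ a b : Fin k, a = b := fun a b => hJ (Subsingleton.elim _ _)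
    have hk1 : k = 1 := by
      by_contra hne
      have := hsub ⟨0, hk⟩ ⟨1, by omega⟩
      simp at this
    subst hk1
    exact ⟨fun a => 0, fun a => by simp, by simp [bin]⟩
  have htop : ⊤ ≤ bspan J (k - 1) := by
    intro v _
    have hv : v = ∑ b, v b • (Pi.single b (1 : ℚ) : Fin k → ℚ) := by
      funext c; simp [Finset.sum_apply, Pi.single_apply]
    rw [hv]
    refine Submodule.sum_mem _ fun b _ => Submodule.smul_mem _ _ ?_
    have hex : ∀ c, ∃ i, c ≠ b → J b i ≠ J c i := by
      intro c
      by_cases h : c = b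
      · exact ⟨Classical.arbitrary σ, fun hx => absurd h hx⟩
      · have : J b ≠ J c := fun h' => h (hJ h').symm
        obtain ⟨i, hi⟩ := Finsupp.ne_iff.1 this
        exact ⟨i, fun _ => hi⟩
    choose i hi using hex
    have hmem := bspan_prod J (Finset.univ.erase b) i (fun c => (J c (i c) : ℚ))
    have hcard : (Finset.univ.erase b).card = k - 1 := by simp
    rw [hcard] at hmem
    set q : Fin k → ℚ := fun b' => ∏ s ∈ Finset.univ.erase b, ((J b' (i s) : ℚ) - (J s (i s) : ℚ)) with hq
    have hqb : q b ≠ 0 := by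
      rw [hq]
      refine Finset.prod_ne_zero_iff.2 fun c hc => ?_
      have := hi c (Finset.ne_of_mem_erase hc)
      rw [sub_ne_zero]; exact_mod_cast this
    have : (Pi.single b (1 : ℚ) : Fin k → ℚ) = (q b)⁻¹ • q := by
      funext c
      by_cases hc : c = b
      · subst hc; simp [hqb]
      · have : q c = 0 := by
          rw [hq]
          exact Finset.prod_eq_zero (Finset.mem_erase.2 ⟨hc, Finset.mem_univ c⟩) (by simp)
        simp [this, hc]
    rw [this]
    exact Submodule.smul_mem _ _ hmem
  unfold bspan at htop
  let B := Module.Basis.ofSpan htop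
  have hBsub := Module.Basis.ofSpan_subset htop
  have hfr : Module.finrank ℚ (Fin k → ℚ) = k := by simp
  haveI : Fintype ((linearIndepOn_empty ℚ id).extend (Set.empty_subset
    {v : Fin k → ℚ | ∃ I : σ →₀ ℕ, ∑ i, I i ≤ k - 1 ∧ v = fun b => (bin (J b) I : ℚ)}) : Set (Fin k → ℚ)) :=
    @Fintype.ofFinite _ (Module.Finite.finite_basis B)
  have hc := Module.finrank_eq_card_basis B
  rw [hfr] at hc
  let eqv := (Fintype.equivFinOfCardEq hc.symm).symm
  let B' := B.reindex eqv.symm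
  have hB' : ∀ a : Fin k, ∃ I : σ →₀ ℕ, ∑ i, I i ≤ k - 1 ∧ B' a = fun b => (bin (J b) I : ℚ) := by
    intro a
    have h1 : B' a ∈ Set.range B := ⟨eqv a, by simp [B']⟩
    exact hBsub h1
  choose I hI hIB using hB'
  refine ⟨I, fun a => by have := hI a; omega, ?_⟩
  have hli : LinearIndependent ℚ (Matrix.of fun a b => (bin (J b) (I a) : ℚ)).row := by
    have h1 := B'.linearIndependent
    have : (Matrix.of fun a b => (bin (J b) (I a) : ℚ)).row = ⇑B' := by
      funext a; rw [hIB]; rfl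
    rw [this]; exact h1
  rw [Matrix.linearIndependent_rows_iff_isUnit, Matrix.isUnit_iff_isUnit_det] at hli
  exact hli.ne_zero

lemma coeff_prod_of_degree_le (m : MonomialOrder σ) {ι : Type*} (S : Finset ι)
    (q : ι → MvPolynomial σ ℚ) (J : ι → σ →₀ ℕ) (h : ∀ b ∈ S, m.toSyn (m.degree (q b)) ≤ m.toSyn (J b)) :
    m.toSyn (m.degree (∏ b ∈ S, q b)) ≤ m.toSyn (∑ b ∈ S, J b) ∧
    coeff (∑ b ∈ S, J b) (∏ b ∈ S, q b) = ∏ b ∈ S, coeff (J b) (q b) := by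
  classical
  induction S using Finset.induction_on with
  | empty => simp
  | insert a S ha ih =>
    obtain ⟨h1, h2⟩ := ih (fun b hb => h b (Finset.mem_insert_of_mem hb))
    have h3 := h a (Finset.mem_insert_self _ _)
    rw [Finset.prod_insert ha, Finset.sum_insert ha, Finset.prod_insert ha]
    refine ⟨m.degree_mul_le.trans ?_, ?_⟩
    · rw [map_add, map_add]; exact add_le_add h3 h1
    · rw [m.coeff_mul_of_add_of_degree_le h3 h1, h2]

lemma coeff_mono_hd (I e : σ →₀ ℕ) (p : MvPolynomial σ ℚ) :
    coeff e (monomial I 1 * hd I p) = bin e I * coeff e p := by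
  classical
  rw [coeff_monomial_mul']
  split_ifs with h
  · rw [coeff_hd, tsub_add_cancel_of_le h, one_mul]
  · rw [bin_eq_zero h]; simp

lemma gw_echelon (m : MonomialOrder σ) {k : ℕ} (h : Fin k → MvPolynomial σ ℚ)
    (h0 : ∀ b, h b ≠ 0) (hinj : Function.Injective fun b => m.degree (h b)) :
    ∃ I : Fin k → σ →₀ ℕ, (∀ a, ∑ i, I a i < k) ∧
      (Matrix.of fun a b => hd (I a) (h b)).det ≠ 0 := by
  classical
  obtain ⟨I, hI, hdet⟩ := exists_bin_det _ hinj
  refine ⟨I, hI, fun hz => hdet ?_⟩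
  have h1 : (Matrix.of fun a b => (monomial (I a) (1 : ℚ)) *
      (Matrix.of fun a b => hd (I a) (h b)) a b).det = 0 := by
    rw [Matrix.det_mul_column, hz, mul_zero]
  have h2 := congrArg (coeff (∑ b, m.degree (h b))) h1
  have hdeg : ∀ (a b : Fin k), m.toSyn (m.degree (monomial (I a) (1 : ℚ) * hd (I a) (h b)))
      ≤ m.toSyn (m.degree (h b)) := by
    intro a b
    rw [m.degree_le_iff]
    intro c hc
    rw [mem_support_iff, coeff_mono_hd] at hc
    exact m.le_degree (by rw [mem_support_iff]; exact right_ne_zero_of_mul hc)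
  rw [Matrix.det_apply, coeff_sum, coeff_zero] at h2
  have h3 : (Matrix.of fun a b => m.leadingCoeff (h b) *
      (Matrix.of fun a b => (bin (m.degree (h b)) (I a) : ℚ)) a b).det = 0 := by
    rw [Matrix.det_apply, ← h2]
    refine Finset.sum_congr rfl fun τ _ => ?_
    have h4 := (coeff_prod_of_degree_le m Finset.univ
      (fun b => monomial (I (τ b)) (1 : ℚ) * hd (I (τ b)) (h b)) (fun b => m.degree (h b))
      (fun b _ => hdeg _ _)).2
    simp only [Matrix.of_apply]
    rw [Units.smul_def, Units.smul_def, coeff_smul, h4]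
    congr 1
    refine Finset.prod_congr rfl fun b _ => ?_
    rw [coeff_mono_hd, MonomialOrder.leadingCoeff, mul_comm]
  rw [Matrix.det_mul_row] at h3
  refine (mul_eq_zero.1 h3).resolve_left ?_
  refine Finset.prod_ne_zero_iff.2 fun b _ => ?_
  rw [m.leadingCoeff_ne_zero_iff]; exact h0 b

lemma exists_echelon (m : MonomialOrder σ) {k : ℕ} (f : Fin k → MvPolynomial σ ℚ)
    (hf : LinearIndependent ℚ f) :
    ∃ h : Fin k → MvPolynomial σ ℚ, (∀ b, h b ∈ Submodule.span ℚ (Set.range f)) ∧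
      (∀ b, h b ≠ 0) ∧ Function.Injective fun b => m.degree (h b) := by
  classical
  set S := Submodule.span ℚ (Set.range f) with hS
  let Δ : Set (σ →₀ ℕ) := {J | ∃ h ∈ S, h ≠ 0 ∧ m.degree h = J}
  have key : Nonempty (Fin k ↪ Δ) := by
    by_cases hfin : Finite Δ
    · haveI := Fintype.ofFinite Δ
      apply Function.Embedding.nonempty_of_card_le
      let L : MvPolynomial σ ℚ →ₗ[ℚ] (Δ → ℚ) := LinearMap.pi fun J => lcoeff ℚ J.1
      have hker : Disjoint S (LinearMap.ker L) := by
        rw [Submodule.disjoint_def]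
        intro p hp hpk
        by_contra hp0
        have h1 : L p ⟨m.degree p, p, hp, hp0, rfl⟩ = 0 := by
          rw [LinearMap.mem_ker.1 hpk]; rfl
        have h2 : m.leadingCoeff p = 0 := h1
        exact hp0 (m.leadingCoeff_eq_zero_iff.1 h2)
      have := (hf.map hker).fintype_card_le_finrank
      simpa using this
    · rw [not_finite_iff_infinite] at hfin
      exact ⟨(Fin.valEmbedding).trans (Infinite.natEmbedding Δ)⟩
  obtain ⟨emb⟩ := key
  have := fun b => (emb b).2
  choose h hS h0 hdeg using this
  refine ⟨h, hS, h0, fun a b hab => ?_⟩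
  simp only [hdeg] at hab
  exact emb.injective (Subtype.ext hab)

lemma gw (m : MonomialOrder σ) {k : ℕ} (f : Fin k → MvPolynomial σ ℚ) (hf : LinearIndependent ℚ f) :
    ∃ I : Fin k → σ →₀ ℕ, (∀ a, ∑ i, I a i < k) ∧
      (Matrix.of fun a b => hd (I a) (f b)).det ≠ 0 := by
  classical
  obtain ⟨h, hS, h0, hinj⟩ := exists_echelon m f hf
  obtain ⟨I, hI, hdet⟩ := gw_echelon m h h0 hinj
  refine ⟨I, hI, fun hz => hdet ?_⟩
  have : ∀ b, ∃ c : Fin k → ℚ, ∑ i, c i • f i = h b := fun b =>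
    (Submodule.mem_span_range_iff_exists_fun ℚ).1 (hS b)
  choose c hc using this
  have hm : (Matrix.of fun a b => hd (I a) (h b)) =
      (Matrix.of fun a b => hd (I a) (f b)) * (Matrix.of fun i b => (C (c b i) : MvPolynomial σ ℚ)) := by
    ext1 a b
    rw [Matrix.mul_apply]
    simp only [Matrix.of_apply]
    rw [← hc b, map_sum]
    refine Finset.sum_congr rfl fun i _ => ?_
    rw [map_smul, smul_eq_C_mul, mul_comm]
  rw [hm, Matrix.det_mul, hz, zero_mul]

end gw
end Rid

namespace Rid
open MvPolynomial

section ten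
variable {n : ℕ}

/-- product of polynomials in separate variables -/
noncomputable def ten (f : MvPolynomial (Fin n) ℚ) (g : MvPolynomial (Fin 1) ℚ) :
    MvPolynomial (Fin (n + 1)) ℚ :=
  rename Fin.succ f * rename (fun _ => (0 : Fin (n + 1))) g

lemma single_eq (b : Fin 1 →₀ ℕ) : b = Finsupp.single 0 (b 0) := by
  ext; simp

lemma coeff_ten (f : MvPolynomial (Fin n) ℚ) (g : MvPolynomial (Fin 1) ℚ) (e : Fin (n + 1) →₀ ℕ) :
    coeff e (ten f g) = coeff e.tail f * coeff (Finsupp.single 0 (e 0)) g := by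
  classical
  unfold ten
  induction f using MvPolynomial.induction_on' with
  | add p q hp hq => rw [map_add, add_mul, coeff_add, coeff_add, hp, hq, add_mul]
  | monomial a x =>
    induction g using MvPolynomial.induction_on' with
    | add p q hp hq => rw [map_add, mul_add, coeff_add, coeff_add, hp, hq, mul_add]
    | monomial b y =>
      rw [rename_monomial, rename_monomial, monomial_mul, coeff_monomial, coeff_monomial, coeff_monomial]
      have h1 : (Finsupp.mapDomain Fin.succ a + Finsupp.mapDomain (fun _ => (0 : Fin (n + 1))) b)
          = Finsupp.cons (b 0) a := by
        rw [single_eq b, Finsupp.mapDomain_single]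
        ext i
        refine Fin.cases ?_ (fun j => ?_) i
        · rw [Finsupp.add_apply, Finsupp.mapDomain_notin_range]
          · simp
          · rintro ⟨j, hj⟩; exact Fin.succ_ne_zero j hj
        · rw [Finsupp.add_apply, Finsupp.mapDomain_apply (Fin.succ_injective n)]
          simp [Finsupp.single_apply, (Fin.succ_ne_zero j).symm]
      rw [h1]
      have h2 : (Finsupp.cons (b 0) a = e) ↔ (a = e.tail ∧ b = Finsupp.single 0 (e 0)) := by
        constructor
        · rintro rfl
          refine ⟨by simp, ?_⟩
          rw [Finsupp.cons_zero]; exact single_eq b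
        · rintro ⟨rfl, hb⟩
          have : b 0 = e 0 := by rw [hb]; simp
          rw [this, Finsupp.cons_tail]
      by_cases ha : a = e.tail
      · by_cases hb : b = Finsupp.single 0 (e 0)
        · rw [if_pos (h2.2 ⟨ha, hb⟩), if_pos ha, if_pos hb]
        · rw [if_neg (fun h => hb (h2.1 h).2), if_neg hb, mul_zero]
      · rw [if_neg (fun h => ha (h2.1 h).1), if_neg ha, zero_mul]

lemma hd_ten (I : Fin (n + 1) →₀ ℕ) (f : MvPolynomial (Fin n) ℚ) (g : MvPolynomial (Fin 1) ℚ) :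
    hd I (ten f g) = ten (hd I.tail f) (hd (Finsupp.single 0 (I 0)) g) := by
  ext e
  rw [coeff_hd, coeff_ten, coeff_ten, coeff_hd, coeff_hd]
  have h1 : (e + I).tail = e.tail + I.tail := by ext i; simp [Finsupp.tail_apply]
  have h2 : (bin (e + I) I : ℚ) = bin (e.tail + I.tail) I.tail *
      bin (Finsupp.single (0 : Fin 1) (e 0) + Finsupp.single 0 (I 0)) (Finsupp.single 0 (I 0)) := by
    unfold bin
    rw [Fin.prod_univ_succ]
    push_cast
    simp [Finsupp.tail_apply, mul_comm]
  rw [h2, h1]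
  have h3 : Finsupp.single (0 : Fin 1) ((e + I) 0) = Finsupp.single 0 (e 0) + Finsupp.single 0 (I 0) := by
    simp
  rw [h3]; ring

lemma shift_ten (ξ : Fin (n + 1) → ℚ) (f : MvPolynomial (Fin n) ℚ) (g : MvPolynomial (Fin 1) ℚ) :
    shift ξ (ten f g) = ten (shift (fun i => ξ i.succ) f) (shift (fun _ => ξ 0) g) := by
  unfold ten
  rw [map_mul]
  congr 1
  · have : (shift ξ).comp (rename Fin.succ) = (rename Fin.succ).comp (shift (fun i => ξ i.succ)) := by
      ext i : 1
      simp [shift]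
    exact congrArg (fun F => F f) this
  · have : (shift ξ).comp (rename (fun _ => (0 : Fin (n + 1)))) =
        (rename (fun _ => (0 : Fin (n + 1)))).comp (shift (fun _ : Fin 1 => ξ 0)) := by
      ext i : 1
      simp [shift]
    exact congrArg (fun F => F g) this

lemma det_ten {k : ℕ} (f : Fin k → MvPolynomial (Fin n) ℚ) (g : Fin k → MvPolynomial (Fin 1) ℚ)
    (I : Fin k → Fin n →₀ ℕ) (J : Fin k → Fin 1 →₀ ℕ) :
    (Matrix.of fun a c => hd (Finsupp.cons (J c 0) (I a)) (∑ b, ten (f b) (g b))).det =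
      ten (Matrix.of fun a b => hd (I a) (f b)).det (Matrix.of fun c b => hd (J c) (g b)).det := by
  have h1 : (Matrix.of fun a c => hd (Finsupp.cons (J c 0) (I a)) (∑ b, ten (f b) (g b))) =
      ((rename Fin.succ : MvPolynomial (Fin n) ℚ →ₐ[ℚ] _).mapMatrix (Matrix.of fun a b => hd (I a) (f b))) *
      ((rename (fun _ => (0 : Fin (n + 1))) : MvPolynomial (Fin 1) ℚ →ₐ[ℚ] _).mapMatrix
        (Matrix.of fun c b => hd (J c) (g b))).transpose := by
    ext1 a c
    rw [Matrix.mul_apply]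
    simp only [Matrix.of_apply, map_sum]
    refine Finset.sum_congr rfl fun b _ => ?_
    rw [hd_ten, Finsupp.tail_cons, Finsupp.cons_zero, ← single_eq]
    simp [ten]
  rw [h1, Matrix.det_mul, Matrix.det_transpose, ← AlgHom.map_det, ← AlgHom.map_det]
  rfl

lemma exists_decomp (P : MvPolynomial (Fin (n + 1)) ℚ) (hP : P ≠ 0) :
    ∃ k : ℕ, 0 < k ∧ k ≤ degreeOf 0 P + 1 ∧ ∃ f : Fin k → MvPolynomial (Fin n) ℚ,
      ∃ g : Fin k → MvPolynomial (Fin 1) ℚ, LinearIndependent ℚ f ∧ LinearIndependent ℚ g ∧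
      P = ∑ b, ten (f b) (g b) := by
  classical
  set d := degreeOf 0 P with hd
  let φ : Fin (d + 1) → MvPolynomial (Fin n) ℚ := fun j => (finSuccEquiv ℚ n P).coeff j
  let S := Submodule.span ℚ (Set.range φ)
  haveI : Module.Finite ℚ S := Module.Finite.span_of_finite ℚ (Set.finite_range φ)
  let k := Module.finrank ℚ S
  let B := Module.finBasis ℚ S
  let φ' : Fin (d + 1) → S := fun j => ⟨φ j, Submodule.subset_span ⟨j, rfl⟩⟩
  let g : Fin k → MvPolynomial (Fin 1) ℚ :=
    fun b => ∑ j : Fin (d + 1), monomial (Finsupp.single 0 (j : ℕ)) (B.repr (φ' j) b)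
  have hg : ∀ (b : Fin k) (r : ℕ) (hr : r < d + 1), coeff (Finsupp.single 0 r) (g b) = B.repr (φ' ⟨r, hr⟩) b := by
    intro b r hr
    simp only [g, coeff_sum, coeff_monomial]
    rw [Finset.sum_eq_single ⟨r, hr⟩]
    · simp
    · intro j _ hj
      rw [if_neg]
      intro h
      apply hj
      have := congrArg (fun F : Fin 1 →₀ ℕ => F 0) h
      simp at this
      exact Fin.ext this
    · simp
  have hg' : ∀ (b : Fin k) (r : ℕ) (hr : ¬ r < d + 1), coeff (Finsupp.single 0 r) (g b) = 0 := by
    intro b r hr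
    simp only [g, coeff_sum, coeff_monomial]
    refine Finset.sum_eq_zero fun j _ => if_neg fun h => ?_
    have := congrArg (fun F : Fin 1 →₀ ℕ => F 0) h
    simp at this
    omega
  have hPeq : P = ∑ b, ten (B b : MvPolynomial (Fin n) ℚ) (g b) := by
    ext e
    rw [coeff_sum]
    simp only [coeff_ten]
    by_cases he : e 0 < d + 1
    · have h1 : φ ⟨e 0, he⟩ = ∑ b, B.repr (φ' ⟨e 0, he⟩) b • (B b : MvPolynomial (Fin n) ℚ) := by
        have := congrArg (Subtype.val) (B.sum_repr (φ' ⟨e 0, he⟩))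
        rw [Submodule.coe_sum] at this
        exact this.symm
      have h2 := congrArg (coeff e.tail) h1
      simp only [φ, finSuccEquiv_coeff_coeff, Finsupp.cons_tail, coeff_sum, coeff_smul, smul_eq_mul] at h2
      rw [h2]
      refine Finset.sum_congr rfl fun b _ => ?_
      rw [hg _ _ he, mul_comm]
    · rw [Finset.sum_eq_zero (fun b _ => by rw [hg' _ _ he, mul_zero])]
      rw [← notMem_support_iff]
      intro h
      have := monomial_le_degreeOf 0 h
      omega
  refine ⟨k, ?_, ?_, fun b => (B b : MvPolynomial (Fin n) ℚ), g, ?_, ?_, hPeq⟩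
  · rcases Nat.eq_zero_or_pos k with hk | hk
    · exfalso
      apply hP
      rw [hPeq]
      apply Finset.sum_eq_zero
      intro b
      exact absurd b.2 (by omega)
    · exact hk
  · have := finrank_range_le_card (R := ℚ) φ
    simpa [Set.finrank] using this
  · exact B.linearIndependent.map' S.subtype (by simp)
  · rw [Fintype.linearIndependent_iff]
    intro l hl
    let F : S →ₗ[ℚ] ℚ := ∑ b, l b • (B.coord b)
    have hF : F = 0 := by
      have hspan : Submodule.span ℚ (Set.range φ') = ⊤ := by
        have := Submodule.span_span_coe_preimage (R := ℚ) (s := Set.range φ)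
        convert this using 2
        ext x
        constructor
        · rintro ⟨j, rfl⟩; exact ⟨j, rfl⟩
        · rintro ⟨j, hj⟩; exact ⟨j, Subtype.ext hj⟩
      refine LinearMap.ext_on_range hspan fun j => ?_
      have := congrArg (coeff (Finsupp.single 0 (j : ℕ))) hl
      rw [coeff_sum, coeff_zero] at this
      simp only [coeff_smul, hg _ _ j.2] at this
      simpa [F] using this
    intro b
    have := congrArg (fun G => G (B b)) hF
    simpa [F, Finsupp.single_apply] using this

end ten

lemma one_var (V : MvPolynomial (Fin 1) ℚ) (hV : V ≠ 0) (ξ : ℚ) (c : ℕ → ℤ) (u : ℚ) (hu : u ≠ 0)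
    (hc : ∀ r, (c r : ℚ) = u * coeff (Finsupp.single 0 r) V) (B : ℕ) (hB : ∀ r, (c r).natAbs ≤ B) :
    ∃ t : ℕ, coeff (Finsupp.single 0 t) (shift (fun _ => ξ) V) ≠ 0 ∧ ξ.den ^ t ≤ B := by
  classical
  let Φ : MvPolynomial (Fin 1) ℚ →ₐ[ℚ] Polynomial ℚ := aeval (fun _ => Polynomial.X)
  have hΦ : ∀ W r, (Φ W).coeff r = coeff (Finsupp.single 0 r) W := by
    intro W r
    induction W using MvPolynomial.induction_on' with
    | add p q hp hq => rw [map_add, Polynomial.coeff_add, coeff_add, hp, hq]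
    | monomial a x =>
      rw [single_eq a]
      simp only [Φ, aeval_monomial, coeff_monomial]
      simp [Finsupp.prod_single_index, Polynomial.coeff_X_pow, Finsupp.single_left_inj, eq_comm]
  have hs : Φ (shift (fun _ => ξ) V) = (Φ V).comp (Polynomial.X + Polynomial.C ξ) := by
    have : Φ.comp (shift (fun _ => ξ)) =
        (Polynomial.aeval (Polynomial.X + Polynomial.C ξ : Polynomial ℚ)).comp Φ := by
      ext i : 1
      simp [Φ, shift]
    exact congrArg (fun F => F V) this
  have hΦ0 : Φ V ≠ 0 := by
    intro h
    apply hV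
    ext e
    rw [single_eq e, ← hΦ, h]; simp
  obtain ⟨t, ht⟩ : ∃ t, t = (Φ V).rootMultiplicity ξ := ⟨_, rfl⟩
  refine ⟨t, ?_, ?_⟩
  · rw [← hΦ, hs, ht, Polynomial.rootMultiplicity_eq_natTrailingDegree]
    have h0 : (Φ V).comp (Polynomial.X + Polynomial.C ξ) ≠ 0 := by
      intro h
      rw [← hs] at h
      have h2 : shift (fun _ => ξ) V = 0 := by
        ext e; rw [single_eq e, ← hΦ, h]; simp
      exact shift_ne_zero _ hV h2
    have := Polynomial.trailingCoeff_nonzero_iff_nonzero.2 h0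
    exact this
  · have hdvd : (Polynomial.X - Polynomial.C ξ) ^ t ∣ Φ V := by
      rw [ht]; exact Polynomial.pow_rootMultiplicity_dvd _ _
    let N := (Φ V).natDegree
    let V' : Polynomial ℤ := ∑ r ∈ Finset.range (N + 1), Polynomial.monomial r (c r)
    have hV'c : ∀ r, V'.coeff r = c r := by
      intro r
      simp only [V', Polynomial.finset_sum_coeff, Polynomial.coeff_monomial]
      by_cases hr : r < N + 1
      · simp [hr]
      · have : (c r : ℚ) = 0 := by
          rw [hc, ← hΦ, Polynomial.coeff_eq_zero_of_natDegree_lt (by omega), mul_zero]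
        have : c r = 0 := by exact_mod_cast this
        simp [this]
    have hmap : V'.map (Int.castRingHom ℚ) = Polynomial.C u * Φ V := by
      ext r
      rw [Polynomial.coeff_map, hV'c, Polynomial.coeff_C_mul, hΦ]
      exact hc r
    have hV'0 : V' ≠ 0 := by
      intro h
      rw [h, Polynomial.map_zero] at hmap
      exact (mul_ne_zero (Polynomial.C_ne_zero.2 hu) hΦ0) hmap.symm
    let Q : Polynomial ℤ := Polynomial.C (ξ.den : ℤ) * Polynomial.X - Polynomial.C ξ.num
    have hQp : Q.IsPrimitive := by
      intro r hr
      have h1 := (Polynomial.C_dvd_iff_dvd_coeff r Q).1 hr 1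
      have h0 := (Polynomial.C_dvd_iff_dvd_coeff r Q).1 hr 0
      simp only [Q, Polynomial.coeff_sub, Polynomial.coeff_C_mul, Polynomial.coeff_X_one, Polynomial.coeff_X_zero, Polynomial.coeff_C] at h1 h0
      norm_num at h1 h0
      have hcop : IsCoprime ξ.num (ξ.den : ℤ) := by
        rw [Int.isCoprime_iff_nat_coprime]; simpa using ξ.reduced
      exact hcop.isUnit_of_dvd' h0 h1
    have hQpt : (Q ^ t).IsPrimitive := by
      clear hdvd ht
      induction t with
      | zero => rw [pow_zero]; exact Polynomial.isPrimitive_one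
      | succ t ih => rw [pow_succ]; exact ih.mul hQp
    have hQmap : Q.map (Int.castRingHom ℚ) = Polynomial.C (ξ.den : ℚ) * (Polynomial.X - Polynomial.C ξ) := by
      simp only [Q, Polynomial.map_sub, Polynomial.map_mul, Polynomial.map_X, Polynomial.map_C, mul_sub,
        ← Polynomial.C_mul]
      have : (ξ.den : ℚ) * ξ = ξ.num := by rw [mul_comm]; exact Rat.mul_den_eq_num ξ
      rw [this]; simp
    have hd1 : (Q ^ t) ∣ V' := by
      rw [Polynomial.IsPrimitive.Int.dvd_iff_map_cast_dvd_map_cast _ _ hQpt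
        , hmap, Polynomial.map_pow, hQmap, mul_pow]
      have hunit : IsUnit (Polynomial.C (ξ.den : ℚ) ^ t) := by
        apply IsUnit.pow
        rw [Polynomial.isUnit_C]
        exact isUnit_iff_ne_zero.2 (by exact_mod_cast ξ.den_nz)
      rw [hunit.mul_left_dvd]
      exact Dvd.dvd.mul_left hdvd _
    have hlc := Polynomial.leadingCoeff_dvd_leadingCoeff hd1
    have hQlc : Q.leadingCoeff = ξ.den := by
      have h1 : Q = Polynomial.C (ξ.den : ℤ) * Polynomial.X + Polynomial.C (-ξ.num) := by
        simp [Q, sub_eq_add_neg]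
      rw [h1, Polynomial.leadingCoeff_linear (by exact_mod_cast ξ.den_nz)]
    rw [Polynomial.leadingCoeff_pow, hQlc] at hlc
    have h3 := Int.natAbs_dvd_natAbs.2 hlc
    have h4 := Nat.le_of_dvd (by simpa using hV'0) h3
    rw [Int.natAbs_pow, Int.natAbs_natCast] at h4
    refine h4.trans ?_
    rw [Polynomial.leadingCoeff, hV'c]
    exact hB _

end Rid

namespace Rid
open MvPolynomial

lemma roth_alg {n : ℕ} (P : MvPolynomial (Fin (n + 1)) ℤ) (hP : P ≠ 0) (ξ : Fin (n + 1) → ℚ) :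
    ∃ (k : ℕ) (I : Fin k → Fin n →₀ ℕ) (J : Fin k → ℕ) (W : MvPolynomial (Fin (n + 1)) ℤ)
      (U : MvPolynomial (Fin n) ℤ), 0 < k ∧ k ≤ degreeOf 0 P + 1 ∧ (∀ a, ∑ i, I a i < k) ∧
      Function.Injective J ∧ (∀ c, J c < k) ∧
      W = (Matrix.of fun a c => hd (Finsupp.cons (J c) (I a)) P).det ∧ U ≠ 0 ∧
      (∀ i, degreeOf i U ≤ degreeOf i.succ W) ∧ l1 U ≤ l1 W ∧
      ∀ m, coeff m (shift (fun i => ξ i.succ) (MvPolynomial.map (Int.castRingHom ℚ) U)) ≠ 0 →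
        ∃ t, coeff (Finsupp.cons t m) (shift ξ (MvPolynomial.map (Int.castRingHom ℚ) W)) ≠ 0 ∧
          (ξ 0).den ^ t ≤ l1 W := by
  classical
  set Q := MvPolynomial.map (Int.castRingHom ℚ) P with hQ
  have hinj : Function.Injective (Int.castRingHom ℚ) := Int.cast_injective
  have hQ0 : Q ≠ 0 := by
    intro h
    apply hP
    apply MvPolynomial.map_injective _ hinj
    rw [← hQ, h, map_zero]
  obtain ⟨k, hk0, hk, f, g, hf, hg, hdec⟩ := exists_decomp Q hQ0
  have hkd : degreeOf 0 Q ≤ degreeOf 0 P := by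
    rw [degreeOf_le_iff]
    intro m hm
    exact degreeOf_le_iff.1 le_rfl m (support_map_subset _ _ hm)
  obtain ⟨I, hI, hF⟩ := gw MonomialOrder.lex f hf
  obtain ⟨J, hJ, hG⟩ := gw MonomialOrder.lex g hg
  set F := (Matrix.of fun a b => hd (I a) (f b)).det with hFdef
  set V := (Matrix.of fun a b => hd (J a) (g b)).det with hVdef
  let W : MvPolynomial (Fin (n + 1)) ℤ := (Matrix.of fun a c => hd (Finsupp.cons (J c 0) (I a)) P).det
  have hW : MvPolynomial.map (Int.castRingHom ℚ) W = ten F V := by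
    rw [hFdef, hVdef, ← det_ten, ← hdec]
    simp only [W]
    rw [RingHom.map_det]
    congr 1
    ext1 a
    intro c
    simp [RingHom.mapMatrix_apply, map_hd, hQ]
  have hcW : ∀ e, ((coeff e W : ℤ) : ℚ) = coeff e.tail F * coeff (Finsupp.single 0 (e 0)) V := by
    intro e
    rw [← coeff_ten, ← hW, coeff_map]; rfl
  obtain ⟨r, hr⟩ : ∃ r, coeff (Finsupp.single 0 r) V ≠ 0 := by
    by_contra! h
    apply hG
    ext e
    rw [single_eq e, h, coeff_zero]
  obtain ⟨e0, he0⟩ := MvPolynomial.ne_zero_iff.1 hF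
  let U : MvPolynomial (Fin n) ℤ := Polynomial.coeff (finSuccEquiv ℤ n W) r
  have hUc : ∀ m, coeff m U = coeff (Finsupp.cons r m) W := fun m => finSuccEquiv_coeff_coeff m W r
  have hU : MvPolynomial.map (Int.castRingHom ℚ) U = C (coeff (Finsupp.single 0 r) V) * F := by
    ext m
    rw [coeff_map, hUc, coeff_C_mul]
    have := hcW (Finsupp.cons r m)
    simp only [Finsupp.tail_cons, Finsupp.cons_zero] at this
    rw [mul_comm, ← this]; rfl
  refine ⟨k, I, fun c => J c 0, W, U, hk0, hk.trans (by omega), hI, ?_, ?_, rfl, ?_, ?_, ?_, ?_⟩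
  · intro a b hab
    by_contra hne
    apply hG
    rw [hVdef]
    apply Matrix.det_zero_of_row_eq hne
    have : J a = J b := by rw [single_eq (J a), single_eq (J b)]; simp only at hab; rw [hab]
    funext c
    simp [this]
  · intro c
    have := hJ c
    simpa using this
  · intro h
    rw [h, map_zero] at hU
    exact mul_ne_zero (by simpa using hr) hF hU.symm
  · intro i
    exact degreeOf_coeff_finSuccEquiv W i r
  · have hi : Function.Injective (fun m : Fin n →₀ ℕ => (Finsupp.cons r m : Fin (n + 1) →₀ ℕ)) :=
      fun a b h => by simpa using congrArg Finsupp.tail h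
    rw [l1_eq W (W.support ∪ U.support.map ⟨_, hi⟩) Finset.subset_union_left]
    refine le_trans ?_ (Finset.sum_le_sum_of_subset Finset.subset_union_right)
    rw [Finset.sum_map]
    unfold l1
    apply le_of_eq
    apply Finset.sum_congr rfl
    intro m _
    rw [hUc]; rfl
  · intro m hm
    rw [hU, map_mul] at hm
    have hm' : coeff m (shift (fun i => ξ i.succ) F) ≠ 0 := by
      intro h
      apply hm
      simp only [shift, algHom_C, algebraMap_eq, coeff_C_mul] at h ⊢
      rw [h, mul_zero]
    obtain ⟨t, ht, htB⟩ := one_var V hG (ξ 0) (fun r => coeff (Finsupp.cons r e0) W) (coeff e0 F) he0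
      (by intro r; rw [hcW]; simp) (l1 W) (fun r => coeff_le_l1 _ _)
    refine ⟨t, ?_, htB⟩
    rw [hW, shift_ten, coeff_ten]
    simp only [Finsupp.tail_cons, Finsupp.cons_zero]
    exact mul_ne_zero hm' ht

end Rid

namespace Rid
open MvPolynomial

lemma sum_lower {k : ℕ} (hk : 0 < k) (J : Fin k → ℕ) (hJ : Function.Injective J) (hJk : ∀ c, J c < k)
    (δ D K₀ : ℝ) (hδ : 0 < δ) (hδ1 : δ ≤ 1) (hD : 0 < D) (hK : 0 ≤ K₀) (hkD : ((k : ℝ) - 1) * K₀ ≤ D) :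
    (k : ℝ) * (δ ^ 2 * D / 32) ≤ ∑ c, max 0 (δ * D / 2 - J c * K₀) := by
  have hk1 : (1 : ℝ) ≤ k := by exact_mod_cast hk
  have hbij : Function.Bijective (fun c => (⟨J c, hJk c⟩ : Fin k)) := by
    apply Finite.injective_iff_bijective.1
    intro a b h
    apply hJ
    simpa using h
  have h1 : ∑ c, max 0 (δ * D / 2 - J c * K₀) = ∑ j : Fin k, max 0 (δ * D / 2 - (j : ℕ) * K₀) :=
    Function.Bijective.sum_comp hbij (fun j : Fin k => max 0 (δ * D / 2 - (j : ℕ) * K₀))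
  rw [h1, Fin.sum_univ_eq_sum_range (fun j => max 0 (δ * D / 2 - (j : ℕ) * K₀))]
  have hx : 0 ≤ δ * (k - 1) / 4 := by
    have := sub_nonneg.2 hk1
    positivity
  set r := ⌊δ * ((k : ℝ) - 1) / 4⌋₊ + 1 with hr
  have hfl := Nat.floor_le hx
  have hfl2 : δ * ((k : ℝ) - 1) / 4 < r := by rw [hr]; push_cast; exact Nat.lt_floor_add_one _
  have hr1 : (1 : ℝ) ≤ r := by rw [hr]; push_cast; linarith [Nat.cast_nonneg (α := ℝ) ⌊δ * ((k : ℝ) - 1) / 4⌋₊]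
  have hrk : r ≤ k := by
    have : (⌊δ * ((k : ℝ) - 1) / 4⌋₊ : ℝ) < k := by nlinarith
    have : ⌊δ * ((k : ℝ) - 1) / 4⌋₊ < k := by exact_mod_cast this
    omega
  calc (k : ℝ) * (δ ^ 2 * D / 32) = (δ * k / 8) * (δ * D / 4) := by ring
    _ ≤ r * (δ * D / 4) := by
      apply mul_le_mul_of_nonneg_right _ (by positivity)
      nlinarith
    _ = ∑ j ∈ Finset.range r, δ * D / 4 := by simp
    _ ≤ ∑ j ∈ Finset.range r, max 0 (δ * D / 2 - (j : ℕ) * K₀) := by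
      apply Finset.sum_le_sum
      intro j hj
      apply le_max_of_le_right
      have : j ≤ ⌊δ * ((k : ℝ) - 1) / 4⌋₊ := by have := Finset.mem_range.1 hj; omega
      have : (j : ℝ) ≤ δ * ((k : ℝ) - 1) / 4 := le_trans (by exact_mod_cast this) hfl
      have : (j : ℝ) * K₀ ≤ δ * ((k : ℝ) - 1) / 4 * K₀ := mul_le_mul_of_nonneg_right this hK
      nlinarith
    _ ≤ _ := by
      apply Finset.sum_le_sum_of_subset_of_nonneg
      · intro j hj; simp at *; omega
      · intros; exact le_max_left _ _

def RL (n : ℕ) : Prop := ∀ δ : ℝ, 0 < δ → δ ≤ 1 → ∃ ω : ℝ, 0 < ω ∧ ∃ G : ℕ, 1 ≤ G ∧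
  ∀ K : Fin n → ℕ, (∀ i, G ≤ K i) → (∀ i j, i < j → G * K j ≤ K i) →
  ∀ ξ : Fin n → ℚ, (∀ i, 2 ^ (K i) ≤ (ξ i).den ^ 2) → ∀ D : ℝ, 0 < D →
  ∀ P : MvPolynomial (Fin n) ℤ, P ≠ 0 → (∀ i, (degreeOf i P : ℝ) * K i ≤ D) →
  (l1 P : ℝ) ≤ 2 ^ (ω * D) →
  ∃ e, coeff e (shift ξ (MvPolynomial.map (Int.castRingHom ℚ) P)) ≠ 0 ∧ ∑ i, (e i : ℝ) * K i ≤ δ * D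

lemma map_ne {n : ℕ} {P : MvPolynomial (Fin n) ℤ} (hP : P ≠ 0) :
    MvPolynomial.map (Int.castRingHom ℚ) P ≠ 0 := by
  intro h
  apply hP
  apply MvPolynomial.map_injective (Int.castRingHom ℚ) Int.cast_injective
  rw [h, map_zero]

lemma RL_zero : RL 0 := by
  intro δ hδ hδ1
  refine ⟨1, one_pos, 1, le_rfl, ?_⟩
  intro K _ _ ξ _ D hD P hP _ _
  obtain ⟨e, he⟩ := MvPolynomial.ne_zero_iff.1 (shift_ne_zero ξ (map_ne hP))
  exact ⟨e, he, by simp; positivity⟩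

lemma l1_W_le {n k : ℕ} (P : MvPolynomial (Fin (n + 1)) ℤ) 
    (L : Fin k → Fin k → Fin (n + 1) →₀ ℕ) (hk : k ≤ degreeOf 0 P + 1) (ω ω' D G : ℝ) (hD : 0 < D) (hG : 0 < G)
    (hdd : ∀ i, (degreeOf i P : ℝ) * G ≤ D)
    (h1 : (l1 P : ℝ) ≤ 2 ^ (ω * D)) (hω : (n + 2) / G + ω ≤ ω') :
    (l1 (Matrix.of fun a c => hd (L a c) P).det : ℝ) ≤ 2 ^ (ω' * (k * D)) := by
  have h2 := l1_det_le (Matrix.of fun a c => Rid.hd (L a c) P) _ (fun a b => l1_hd_le (L a b) P)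
  have h3 : k.factorial ≤ (2 ^ (degreeOf 0 P)) ^ k := by
    refine (Nat.factorial_le_pow k).trans (Nat.pow_le_pow_left ?_ k)
    have := Nat.lt_two_pow_self (n := degreeOf 0 P)
    omega
  have h4 : l1 (Matrix.of fun a c => Rid.hd (L a c) P).det ≤
      (2 ^ (degreeOf 0 P + ∑ i, degreeOf i P) * l1 P) ^ k := by
    refine h2.trans ((Nat.mul_le_mul_right _ h3).trans (le_of_eq ?_))
    rw [← mul_pow, pow_add, mul_assoc]
  have hdi : ∀ i, (degreeOf i P : ℝ) ≤ D / G := fun i => by rw [le_div_iff₀ hG]; exact hdd i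
  have h5 : ((degreeOf 0 P + ∑ i, degreeOf i P : ℕ) : ℝ) ≤ (n + 2) / G * D := by
    push_cast
    have : ∑ i, (degreeOf i P : ℝ) ≤ ∑ i : Fin (n + 1), D / G := Finset.sum_le_sum fun i _ => hdi i
    simp at this
    have h0 := hdi 0
    calc _ ≤ D / G + (n + 1) * (D / G) := by linarith
      _ = _ := by ring
  calc (l1 (Matrix.of fun a c => Rid.hd (L a c) P).det : ℝ) ≤
      (2 ^ (degreeOf 0 P + ∑ i, degreeOf i P) * l1 P) ^ k := by exact_mod_cast h4
    _ ≤ (2 ^ ((n + 2) / G * D) * 2 ^ (ω * D)) ^ k := by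
      gcongr
      rw [← Real.rpow_natCast]
      exact Real.rpow_le_rpow_of_exponent_le (by norm_num) h5
    _ = (2 ^ (((n + 2) / G + ω) * D)) ^ k := by
      rw [← Real.rpow_add (by norm_num)]; ring_nf
    _ ≤ (2 ^ (ω' * D)) ^ k := by
      gcongr; norm_num
    _ = 2 ^ (ω' * (k * D)) := by
      rw [← Real.rpow_natCast, ← Real.rpow_mul (by norm_num)]; ring_nf

lemma RL_succ (n : ℕ) (ih : RL n) : RL (n + 1) := by
  classical
  intro δ hδ hδ1
  obtain ⟨ω₀, hω₀, G', hG', H⟩ := ih (δ ^ 2 / 100) (by positivity) (by nlinarith)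
  set ω' := min ω₀ (δ ^ 2 / 100) with hω'
  have hω'0 : 0 < ω' := lt_min hω₀ (by positivity)
  set G := max G' (max ⌈4 * (n + 2) / ω'⌉₊ ⌈2 / δ⌉₊) with hGdef
  have hGG' : G' ≤ G := le_max_left _ _
  have hG1 : 1 ≤ G := hG'.trans hGG'
  have hG0 : (0 : ℝ) < G := by exact_mod_cast hG1
  have hGa : 4 * (n + 2) / ω' ≤ (G : ℝ) := (Nat.le_ceil _).trans
    (Nat.cast_le.2 ((le_max_left _ _).trans (le_max_right _ _)))
  have hGb : 2 / δ ≤ (G : ℝ) := (Nat.le_ceil _).trans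
    (Nat.cast_le.2 ((le_max_right _ _).trans (le_max_right _ _)))
  refine ⟨ω' / 2, by positivity, G, hG1, ?_⟩
  intro K hKG hKK ξ hξ D hD P hP hdeg hl1
  obtain ⟨k, I, J, W, U, hk0, hk, hI, hJ, hJk, hW, hU0, hUd, hUl, hUW⟩ := roth_alg P hP ξ
  have hKR : ∀ i, (G : ℝ) ≤ K i := fun i => by exact_mod_cast hKG i
  have hdG : ∀ i, (degreeOf i P : ℝ) * G ≤ D := fun i =>
    (mul_le_mul_of_nonneg_left (hKR i) (Nat.cast_nonneg _)).trans (hdeg i)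
  have hkR : (0 : ℝ) < k := by exact_mod_cast hk0
  have hlW : (l1 W : ℝ) ≤ 2 ^ (ω' * (k * D)) := by
    rw [hW]
    refine l1_W_le P (fun a c => Finsupp.cons (J c) (I a)) hk (ω' / 2) ω' D G hD hG0 hdG hl1 ?_
    have : (n + 2) / (G : ℝ) ≤ ω' / 4 := by
      rw [div_le_iff₀ hG0]
      rw [div_le_iff₀ hω'0] at hGa
      linarith
    linarith
  have hWd : ∀ i, degreeOf i W ≤ k * degreeOf i P := by
    intro i; rw [hW]; exact degreeOf_det_le _ i _ (fun a b => degreeOf_hd_le _ _ _)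
  obtain ⟨m, hm, hmw⟩ := H (fun i => K i.succ) (fun i => hGG'.trans (hKG _))
    (fun i j hij => (Nat.mul_le_mul_right _ hGG').trans (hKK _ _ (Fin.succ_lt_succ_iff.2 hij)))
    (fun i => ξ i.succ) (fun i => hξ _) (k * D) (by positivity) U hU0
    (by
      intro i
      have : (degreeOf i U : ℝ) ≤ k * degreeOf i.succ P := by exact_mod_cast (hUd i).trans (hWd _)
      calc (degreeOf i U : ℝ) * K i.succ ≤ k * degreeOf i.succ P * K i.succ :=
            mul_le_mul_of_nonneg_right this (Nat.cast_nonneg _)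
        _ = k * (degreeOf i.succ P * K i.succ) := by ring
        _ ≤ k * D := mul_le_mul_of_nonneg_left (hdeg _) hkR.le)
    (by
      calc (l1 U : ℝ) ≤ l1 W := by exact_mod_cast hUl
        _ ≤ _ := hlW
        _ ≤ _ := by
          apply Real.rpow_le_rpow_of_exponent_le (by norm_num)
          exact mul_le_mul_of_nonneg_right (min_le_left _ _) (by positivity))
  obtain ⟨t, htc, htd⟩ := hUW m hm
  have ht : (t : ℝ) * K 0 ≤ 2 * (δ ^ 2 / 100) * (k * D) := by
    have h1 : ((2 : ℝ) ^ (K 0 * t)) ≤ 2 ^ (ω' * (k * D) * 2) := by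
      have h2 : 2 ^ (K 0 * t) ≤ (l1 W) ^ 2 := by
        calc 2 ^ (K 0 * t) = (2 ^ (K 0)) ^ t := by rw [pow_mul]
          _ ≤ ((ξ 0).den ^ 2) ^ t := Nat.pow_le_pow_left (hξ 0) t
          _ = ((ξ 0).den ^ t) ^ 2 := by rw [← pow_mul, ← pow_mul, mul_comm]
          _ ≤ _ := Nat.pow_le_pow_left htd 2
      calc ((2 : ℝ) ^ (K 0 * t)) ≤ (l1 W : ℝ) ^ 2 := by exact_mod_cast h2
        _ ≤ (2 ^ (ω' * (k * D))) ^ 2 := by gcongr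
        _ = _ := by rw [← Real.rpow_natCast, ← Real.rpow_mul (by norm_num)]; norm_num
    rw [← Real.rpow_natCast, Real.rpow_le_rpow_left_iff (by norm_num)] at h1
    push_cast at h1
    have : ω' * (k * D) ≤ δ ^ 2 / 100 * (k * D) :=
      mul_le_mul_of_nonneg_right (min_le_right _ _) (by positivity)
    linarith
  by_contra! hcon
  set Q := MvPolynomial.map (Int.castRingHom ℚ) P with hQ
  have hidx : Idx (fun i => (K i : ℝ)) (shift ξ Q) (δ * D) := by
    intro e he
    exact (hcon e (by simpa using he)).le
  have hdetW : shift ξ (MvPolynomial.map (Int.castRingHom ℚ) W) =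
      (Matrix.of fun a c => hd (Finsupp.cons (J c) (I a)) (shift ξ Q)).det := by
    rw [hW, RingHom.map_det, AlgHom.map_det]
    congr 1
    ext1 a
    intro c
    simp [RingHom.mapMatrix_apply, map_hd, hQ, hd_shift]
  have hk1 : ((k : ℝ) - 1) * K 0 ≤ D := by
    refine le_trans (mul_le_mul_of_nonneg_right ?_ (Nat.cast_nonneg _)) (hdeg 0)
    have : (k : ℝ) ≤ degreeOf 0 P + 1 := by exact_mod_cast hk
    linarith
  have hIW : ∀ a, ∑ i, (I a i : ℝ) * K i.succ ≤ δ * D / 2 := by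
    intro a
    have h1 : ∀ i : Fin n, (K i.succ : ℝ) ≤ K 0 / G := by
      intro i
      rw [le_div_iff₀ hG0, mul_comm]
      exact_mod_cast hKK 0 i.succ (Fin.succ_pos i)
    have h2 : (∑ i, (I a i : ℝ)) ≤ k - 1 := by
      have := hI a
      have : (∑ i, I a i) + 1 ≤ k := this
      have : (∑ i, (I a i : ℝ)) + 1 ≤ k := by exact_mod_cast this
      linarith
    calc ∑ i, (I a i : ℝ) * K i.succ ≤ ∑ i, (I a i : ℝ) * (K 0 / G) :=
          Finset.sum_le_sum fun i _ => mul_le_mul_of_nonneg_left (h1 i) (Nat.cast_nonneg _)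
      _ = (∑ i, (I a i : ℝ)) * (K 0 / G) := by rw [Finset.sum_mul]
      _ ≤ (k - 1) * (K 0 / G) := mul_le_mul_of_nonneg_right h2 (by positivity)
      _ = ((k - 1) * K 0) / G := by ring
      _ ≤ D / G := by gcongr
      _ ≤ δ * D / 2 := by
        rw [div_le_iff₀ hG0]
        rw [div_le_iff₀ hδ] at hGb
        nlinarith
  have hidW := idx_det (w := fun i => (K i : ℝ))
    (Matrix.of fun a c => hd (Finsupp.cons (J c) (I a)) (shift ξ Q))
    (fun c => max 0 (δ * D / 2 - J c * K 0)) (by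
      intro a c
      rcases le_total (δ * D / 2 - J c * K 0) 0 with h | h
      · rw [max_eq_left h]
        exact Idx.nonneg (fun i => Nat.cast_nonneg _) _
      · rw [max_eq_right h]
        refine (hidx.hd (Finsupp.cons (J c) (I a))).mono ?_
        rw [Fin.sum_univ_succ]
        simp only [Finsupp.cons_zero, Finsupp.cons_succ]
        have := hIW a
        linarith)
  rw [← hdetW] at hidW
  have h1 := hidW _ (by simpa using htc)
  have h2 := sum_lower hk0 J hJ hJk δ D (K 0) hδ hδ1 hD (Nat.cast_nonneg _) hk1
  rw [Fin.sum_univ_succ] at h1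
  simp only [Finsupp.cons_zero, Finsupp.cons_succ] at h1
  have : 0 < δ ^ 2 * (k * D) := by positivity
  nlinarith

lemma RL_all (n : ℕ) : RL n := by
  induction n with
  | zero => exact RL_zero
  | succ n ih => exact RL_succ n ih

end Rid

namespace Rid
open MvPolynomial

section siegel
attribute [local instance] Matrix.seminormedAddCommGroup

lemma siegel {α β : Type*} [Fintype α] [Fintype β] (A : Matrix α β ℤ) (B : ℝ) (hB : 1 ≤ B)
    (hA : ∀ i j, |(A i j : ℝ)| ≤ B) (hm : 0 < Fintype.card α)
    (hn : 2 * Fintype.card α ≤ Fintype.card β) :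
    ∃ t : β → ℤ, t ≠ 0 ∧ (∀ i, ∑ j, A i j * t j = 0) ∧ ∀ j, |(t j : ℝ)| ≤ Fintype.card β * B := by
  obtain ⟨t, ht, hAt, hb⟩ := Int.Matrix.exists_ne_zero_int_vec_norm_le A (by omega) hm
  refine ⟨t, ht, fun i => congrFun hAt i, fun j => ?_⟩
  have h1 : ‖A‖ ≤ B := (Matrix.norm_le_iff (by linarith)).2 fun i j => by
    rw [Int.norm_eq_abs]; exact hA i j
  have h2 : max 1 ‖A‖ ≤ B := max_le hB h1
  have hn1 : (1 : ℝ) ≤ Fintype.card β := by exact_mod_cast (by omega : 1 ≤ Fintype.card β)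
  have hnR : 2 * (Fintype.card α : ℝ) ≤ Fintype.card β := by exact_mod_cast hn
  have hmR : (0 : ℝ) < Fintype.card α := by exact_mod_cast hm
  have hbase : 1 ≤ (Fintype.card β : ℝ) * max 1 ‖A‖ := by
    have := le_max_left 1 ‖A‖
    nlinarith
  have h3 : |(t j : ℝ)| ≤ ‖t‖ := by rw [← Int.norm_eq_abs]; exact norm_le_pi_norm t j
  calc |(t j : ℝ)| ≤ _ := h3
    _ ≤ _ := hb
    _ ≤ ((Fintype.card β : ℝ) * max 1 ‖A‖) ^ (1 : ℝ) := by
      apply Real.rpow_le_rpow_of_exponent_le hbase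
      rw [div_le_one (by linarith)]
      linarith
    _ = (Fintype.card β : ℝ) * max 1 ‖A‖ := Real.rpow_one _
    _ ≤ _ := by gcongr
end siegel

/-- centred weight -/
noncomputable def cw {n : ℕ} (d : Fin n → ℕ) (e : Fin n → ℕ) : ℝ := ∑ i, ((e i : ℝ) / d i - 1 / 2)

def box {n : ℕ} (d : Fin n → ℕ) : Finset (Fin n → ℕ) := Fintype.piFinset fun i => Finset.range (d i + 1)

lemma card_box {n : ℕ} (d : Fin n → ℕ) : (box d).card = ∏ i, (d i + 1) := by
  simp [box]

lemma exp_one_sum (d : ℕ) (hd : 1 ≤ d) (t : ℝ) :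
    ∑ x ∈ Finset.range (d + 1), Real.exp (t * ((x : ℝ) / d - 1 / 2)) ≤ (d + 1) * Real.exp (t ^ 2 / 8) := by
  have hd0 : (d : ℝ) ≠ 0 := by positivity
  have hdp : (0 : ℝ) < d := by positivity
  have h1 : ∑ x ∈ Finset.range (d + 1), Real.exp (t * ((x : ℝ) / d - 1 / 2)) =
      ∑ x ∈ Finset.range (d + 1), Real.exp (-(t * ((x : ℝ) / d - 1 / 2))) := by
    rw [← Finset.sum_range_reflect]
    apply Finset.sum_congr rfl
    intro x hx
    have hx := Finset.mem_range.1 hx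
    congr 1
    rw [show d + 1 - 1 - x = d - x by omega, Nat.cast_sub (by omega)]
    field_simp
    ring
  have h2 : ∑ x ∈ Finset.range (d + 1), Real.exp (t * ((x : ℝ) / d - 1 / 2)) =
      ∑ x ∈ Finset.range (d + 1), Real.cosh (t * ((x : ℝ) / d - 1 / 2)) := by
    simp only [Real.cosh_eq, ← Finset.sum_div, Finset.sum_add_distrib]
    rw [← h1]; ring
  rw [h2]
  calc _ ≤ ∑ x ∈ Finset.range (d + 1), Real.exp (t ^ 2 / 8) := by
        apply Finset.sum_le_sum
        intro x hx
        have hx : x ≤ d := by have := Finset.mem_range.1 hx; omega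
        refine (Real.cosh_le_exp_half_sq _).trans (Real.exp_le_exp.2 ?_)
        have hx1 : (x : ℝ) / d ≤ 1 := by rw [div_le_one hdp]; exact_mod_cast hx
        have hx0 : 0 ≤ (x : ℝ) / d := by positivity
        have : ((x : ℝ) / d - 1 / 2) ^ 2 ≤ 1 / 4 := by nlinarith
        rw [mul_pow]
        nlinarith [sq_nonneg t]
    _ = _ := by simp

lemma chern {n : ℕ} (d : Fin n → ℕ) (hd : ∀ i, 1 ≤ d i) (t : ℝ) :
    ∑ e ∈ box d, Real.exp (t * cw d e) ≤ (box d).card * Real.exp (n * (t ^ 2 / 8)) := by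
  have h1 : ∀ e, Real.exp (t * cw d e) = ∏ i, Real.exp (t * ((e i : ℝ) / d i - 1 / 2)) := by
    intro e; rw [cw, Finset.mul_sum, Real.exp_sum]
  simp only [h1]
  rw [box, ← Finset.prod_univ_sum (fun i => Finset.range (d i + 1))
    (fun i x => Real.exp (t * ((x : ℝ) / d i - 1 / 2)))]
  calc _ ≤ ∏ i, (((d i : ℝ) + 1) * Real.exp (t ^ 2 / 8)) :=
        Finset.prod_le_prod (fun i _ => Finset.sum_nonneg fun _ _ => (Real.exp_pos _).le)
          (fun i _ => exp_one_sum _ (hd i) t)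
    _ = _ := by
      rw [Finset.prod_mul_distrib]
      simp [Real.exp_nat_mul]

lemma count {n : ℕ} (d : Fin n → ℕ) (hd : ∀ i, 1 ≤ d i) (δ : ℝ) (hδ : 0 < δ) (hn : 4 / δ ^ 2 ≤ n) :
    4 * ((box d).filter fun e => n * δ < |cw d e|).card ≤ (box d).card := by
  set N := ((box d).filter fun e => n * δ < |cw d e|).card
  have h1 : (N : ℝ) * Real.exp (4 * δ * (n * δ)) ≤ 2 * ((box d).card * Real.exp (n * ((4 * δ) ^ 2 / 8))) := by
    calc (N : ℝ) * Real.exp (4 * δ * (n * δ)) = ∑ e ∈ (box d).filter fun e => n * δ < |cw d e|,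
          Real.exp (4 * δ * (n * δ)) := by simp [N]
      _ ≤ ∑ e ∈ (box d).filter fun e => n * δ < |cw d e|,
          (Real.exp (4 * δ * cw d e) + Real.exp (-(4 * δ) * cw d e)) := by
        apply Finset.sum_le_sum
        intro e he
        have he := (Finset.mem_filter.1 he).2
        rcases le_total 0 (cw d e) with h | h
        · rw [abs_of_nonneg h] at he
          have : Real.exp (4 * δ * (n * δ)) ≤ Real.exp (4 * δ * cw d e) :=
            Real.exp_le_exp.2 (by nlinarith)
          linarith [Real.exp_pos (-(4 * δ) * cw d e)]
        · rw [abs_of_nonpos h] at he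
          have : Real.exp (4 * δ * (n * δ)) ≤ Real.exp (-(4 * δ) * cw d e) :=
            Real.exp_le_exp.2 (by nlinarith)
          linarith [Real.exp_pos ((4 * δ) * cw d e)]
      _ ≤ ∑ e ∈ box d, (Real.exp (4 * δ * cw d e) + Real.exp (-(4 * δ) * cw d e)) := by
        apply Finset.sum_le_sum_of_subset_of_nonneg (Finset.filter_subset _ _)
        intros; positivity
      _ ≤ _ := by
        rw [Finset.sum_add_distrib]
        have a := chern d hd (4 * δ)
        have b := chern d hd (-(4 * δ))
        rw [neg_sq] at b
        linarith
  have h2 : (8 : ℝ) ≤ Real.exp (n * (2 * δ ^ 2)) := by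
    have : 8 ≤ n * (2 * δ ^ 2) := by
      rw [div_le_iff₀ (by positivity)] at hn
      linarith
    linarith [Real.add_one_le_exp (n * (2 * δ ^ 2))]
  have h3 : Real.exp (4 * δ * (n * δ)) = Real.exp (n * (2 * δ ^ 2)) * Real.exp (n * ((4 * δ) ^ 2 / 8)) := by
    rw [← Real.exp_add]; ring_nf
  rw [h3, ← mul_assoc, ← mul_assoc 2] at h1
  have h4 := le_of_mul_le_mul_right h1 (Real.exp_pos _)
  have h5 : (4 * N : ℝ) ≤ (box d).card := by
    have : (0:ℝ) ≤ N := Nat.cast_nonneg _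
    nlinarith
  exact_mod_cast h5

/-- the auxiliary polynomial -/
lemma aux {n : ℕ} (d : Fin n → ℕ) (hd1 : ∀ i, 1 ≤ d i) (δ : ℝ) (hδ : 0 < δ) (hδ2 : δ < 1 / 2)
    (hn : 4 / δ ^ 2 ≤ n) :
    ∃ P : MvPolynomial (Fin n) ℤ, P ≠ 0 ∧
      (∀ e ∈ P.support, (∀ i, e i ≤ d i) ∧ |∑ i, ((e i : ℝ) / d i - 1 / 2)| ≤ n * δ) ∧
      (∀ e ∈ (shift (fun _ => (-1 : ℤ)) P).support, (∀ i, e i ≤ d i) ∧ -(n * δ) ≤ ∑ i, ((e i : ℝ) / d i - 1 / 2)) ∧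
      l1 P ≤ 8 ^ (∑ i, d i) := by
  classical
  have hn0 : (0 : ℝ) < n := lt_of_lt_of_le (by positivity) hn
  have hcount := count d hd1 δ hδ hn
  let F : (Fin n → ℕ) → (Fin n →₀ ℕ) := Finsupp.equivFunOnFinite.symm
  have hFi : Function.Injective F := Finsupp.equivFunOnFinite.symm.injective
  have hFa : ∀ e i, F e i = e i := fun e i => rfl
  let α := {e // e ∈ (box d).filter fun e => cw d e < -(n * δ)}
  let β := {e // e ∈ (box d).filter fun e => |cw d e| ≤ n * δ}
  let A : Matrix α β ℤ := fun L e => eval (fun _ => (-1 : ℤ)) (hd (F L.1) (monomial (F e.1) (1 : ℤ)))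
  have hboxmem : ∀ e, e ∈ box d ↔ ∀ i, e i ≤ d i := by
    intro e; simp [box]
  have hA : ∀ L e, |(A L e : ℝ)| ≤ 2 ^ (∑ i, d i) := by
    intro L e
    have h1 : A L e = bin (F e.1) (F L.1) * (∏ i, (-1 : ℤ) ^ ((F e.1 - F L.1) i)) := by
      simp only [A, hd_monomial, eval_monomial, mul_one]
      rw [Finsupp.prod_fintype]
      intro i; simp
    have h2 : |A L e| ≤ 2 ^ (∑ i, d i) := by
      rw [h1, abs_mul, Finset.abs_prod]
      simp only [abs_pow, abs_neg, abs_one, one_pow, Finset.prod_const_one, mul_one]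
      rw [abs_of_nonneg (by positivity)]
      have := bin_le (e := F e.1) (I := F L.1) (d := F d) (fun i => by
        have := (hboxmem _).1 (Finset.mem_filter.1 e.2).1 i
        exact this)
      exact_mod_cast this
    exact_mod_cast h2
  have hcα : Fintype.card α ≤ ((box d).filter fun e => n * δ < |cw d e|).card := by
    rw [Fintype.card_coe]
    apply Finset.card_le_card
    intro e he
    simp only [Finset.mem_filter] at he ⊢
    exact ⟨he.1, by rw [lt_abs]; right; linarith [he.2]⟩
  have hcβ : Fintype.card β + ((box d).filter fun e => n * δ < |cw d e|).card = (box d).card := by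
    rw [Fintype.card_coe, ← Finset.card_filter_add_card_filter_not (s := box d) (fun e => |cw d e| ≤ n * δ)]
    simp only [not_le]
  have hα0 : 0 < Fintype.card α := by
    rw [Fintype.card_pos_iff]
    refine ⟨⟨0, ?_⟩⟩
    rw [Finset.mem_filter, hboxmem]
    refine ⟨fun i => Nat.zero_le _, ?_⟩
    simp [cw]
    nlinarith
  obtain ⟨t, ht0, hAt, htb⟩ := siegel A (2 ^ (∑ i, d i)) (one_le_pow₀ (by norm_num)) hA hα0 (by omega)
  let P : MvPolynomial (Fin n) ℤ := ∑ e : β, monomial (F e.1) (t e)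
  have hPc : ∀ e : β, coeff (F e.1) P = t e := by
    intro e
    simp only [P, coeff_sum, coeff_monomial]
    rw [Finset.sum_eq_single e]
    · simp
    · intro b _ hb
      rw [if_neg]
      intro h
      exact hb (Subtype.ext (hFi h))
    · simp
  have hPs : ∀ e ∈ P.support, ∃ b : β, e = F b.1 := by
    intro e he
    by_contra! h
    rw [mem_support_iff] at he
    apply he
    simp only [P, coeff_sum, coeff_monomial]
    apply Finset.sum_eq_zero
    intro b _
    rw [if_neg (h b).symm]
  refine ⟨P, ?_, ?_, ?_, ?_⟩
  · intro h
    apply ht0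
    funext e
    rw [← hPc, h]; rfl
  · intro e he
    obtain ⟨b, rfl⟩ := hPs e he
    have := Finset.mem_filter.1 b.2
    exact ⟨(hboxmem _).1 this.1, this.2⟩
  · intro e he
    rw [mem_support_iff] at he
    obtain ⟨L, rfl⟩ : ∃ L, e = F L := ⟨⇑e, by ext i; rfl⟩
    rw [coeff_shift] at he
    simp only [P, map_sum] at he
    have hL : L ∈ box d := by
      by_contra hL
      apply he
      apply Finset.sum_eq_zero
      intro b _
      rw [hd_monomial, bin_eq_zero]
      · simp
      · intro hle
        apply hL
        rw [hboxmem]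
        intro i
        exact (hle i).trans ((hboxmem _).1 (Finset.mem_filter.1 b.2).1 i)
    refine ⟨(hboxmem _).1 hL, ?_⟩
    by_contra! hlt
    apply he
    have := hAt ⟨L, Finset.mem_filter.2 ⟨hL, hlt⟩⟩
    rw [← this]
    apply Finset.sum_congr rfl
    intro b _
    simp only [A, hd_monomial, eval_monomial]
    ring
  · have hT : (box d).card ≤ 2 ^ (∑ i, d i) := by
      rw [card_box, ← Finset.prod_pow_eq_pow_sum]
      apply Finset.prod_le_prod' 
      intro i _
      exact Nat.lt_two_pow_self
    have hβT : Fintype.card β ≤ 2 ^ (∑ i, d i) := by omega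
    have htn : ∀ b, (t b).natAbs ≤ 2 ^ (∑ i, d i) * 2 ^ (∑ i, d i) := by
      intro b
      have h1 := htb b
      have h2 : |(t b : ℝ)| ≤ (2 ^ (∑ i, d i) * 2 ^ (∑ i, d i) : ℕ) := by
        refine h1.trans ?_
        push_cast
        gcongr
        exact_mod_cast hβT
      rw [← Int.cast_abs, Int.abs_eq_natAbs] at h2
      exact_mod_cast h2
    calc l1 P ≤ ∑ b : β, l1 (monomial (F b.1) (t b)) := l1_sum_le _ _
      _ ≤ ∑ b : β, 2 ^ (∑ i, d i) * 2 ^ (∑ i, d i) := by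
        apply Finset.sum_le_sum
        intro b _
        rw [l1_eq _ {F b.1} support_monomial_subset]
        simpa using htn b
      _ = Fintype.card β * (2 ^ (∑ i, d i) * 2 ^ (∑ i, d i)) := by simp
      _ ≤ 2 ^ (∑ i, d i) * (2 ^ (∑ i, d i) * 2 ^ (∑ i, d i)) := by gcongr
      _ = 8 ^ (∑ i, d i) := by rw [← mul_pow, ← mul_pow]; norm_num

end Rid

namespace Rid
open MvPolynomial

variable {n : ℕ}

/-- homogenised evaluation -/
noncomputable def hom (p : MvPolynomial (Fin n) ℤ) (d : Fin n → ℕ) (x y : Fin n → ℤ) : ℤ :=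
  ∑ e ∈ p.support, coeff e p * ∏ i, (y i ^ e i * x i ^ (d i - e i))

lemma hom_cast (p : MvPolynomial (Fin n) ℤ) (d : Fin n → ℕ) (x y : Fin n → ℤ) (hx : ∀ i, x i ≠ 0)
    (h : ∀ e ∈ p.support, ∀ i, e i ≤ d i) :
    (hom p d x y : ℚ) = (∏ i, (x i : ℚ) ^ d i) *
      eval (fun i => (y i : ℚ) / x i) (MvPolynomial.map (Int.castRingHom ℚ) p) := by
  rw [eval_map, eval₂_eq', hom, Finset.mul_sum]
  push_cast
  apply Finset.sum_congr rfl
  intro e he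
  rw [mul_left_comm, ← Finset.prod_mul_distrib]
  congr 1
  apply Finset.prod_congr rfl
  intro i _
  have hxi : (x i : ℚ) ≠ 0 := by exact_mod_cast hx i
  rw [div_pow, ← Nat.sub_add_cancel (h e he i), pow_add]
  simp only [Nat.add_sub_cancel]
  field_simp

lemma hom_dvd (p : MvPolynomial (Fin n) ℤ) (d : Fin n → ℕ) (x y : Fin n → ℤ) (N : ℤ)
    (h : ∀ e ∈ p.support, N ∣ ∏ i, (y i ^ e i * x i ^ (d i - e i))) : N ∣ hom p d x y :=
  Finset.dvd_sum fun e he => Dvd.dvd.mul_left (h e he) _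

lemma hom_le (p : MvPolynomial (Fin n) ℤ) (d : Fin n → ℕ) (x y : Fin n → ℤ) (T : ℝ)
    (h : ∀ e ∈ p.support, ∏ i, (|(y i : ℝ)| ^ e i * |(x i : ℝ)| ^ (d i - e i)) ≤ T) :
    |(hom p d x y : ℝ)| ≤ l1 p * T := by
  rw [hom, l1]
  push_cast
  rw [Finset.sum_mul]
  refine (Finset.abs_sum_le_sum_abs _ _).trans (Finset.sum_le_sum fun e he => ?_)
  rw [abs_mul, Finset.abs_prod]
  simp only [abs_mul, abs_pow]
  have : |((coeff e p : ℤ) : ℝ)| = ((coeff e p).natAbs : ℝ) := by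
    rw [← Int.cast_abs, Int.abs_eq_natAbs]; simp
  rw [this]
  exact mul_le_mul_of_nonneg_left (h e he) (Nat.cast_nonneg _)

lemma mem_support_hd {R : Type*} [CommRing R] {I e : Fin n →₀ ℕ} {p : MvPolynomial (Fin n) R}
    (h : e ∈ (hd I p).support) : e + I ∈ p.support := by
  rw [mem_support_iff] at *
  intro h0
  apply h
  rw [coeff_hd, h0, mul_zero]

lemma map_shift (p : MvPolynomial (Fin n) ℤ) (c : ℤ) :
    MvPolynomial.map (Int.castRingHom ℚ) (shift (fun _ => c) p) =
      shift (fun _ => (c : ℚ)) (MvPolynomial.map (Int.castRingHom ℚ) p) := by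
  ext I
  rw [coeff_map, coeff_shift, coeff_shift, ← map_hd, eval_map]
  exact eval₂_comp_left (Int.castRingHom ℚ) (RingHom.id ℤ) (fun _ => c) (hd I p)

lemma hom_shift (P : MvPolynomial (Fin n) ℤ) (I : Fin n →₀ ℕ) (d : Fin n → ℕ) (x y : Fin n → ℤ)
    (hx : ∀ i, x i ≠ 0) (h : ∀ e ∈ P.support, ∀ i, e i ≤ d i)
    (h' : ∀ e ∈ (shift (fun _ => (-1 : ℤ)) P).support, ∀ i, e i ≤ d i) :
    hom (hd I P) d x y = hom (hd I (shift (fun _ => (-1 : ℤ)) P)) d x (fun i => x i + y i) := by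
  have h1 := hom_cast (hd I P) d x y hx (fun e he i => by
    have := h _ (mem_support_hd he) i
    rw [Finsupp.add_apply] at this; omega)
  have h2 := hom_cast (hd I (shift (fun _ => (-1 : ℤ)) P)) d x (fun i => x i + y i) hx (fun e he i => by
    have := h' _ (mem_support_hd he) i
    rw [Finsupp.add_apply] at this; omega)
  have : (hom (hd I P) d x y : ℚ) = hom (hd I (shift (fun _ => (-1 : ℤ)) P)) d x (fun i => x i + y i) := by
    rw [h1, h2, map_hd, map_hd, ← coeff_shift, ← coeff_shift, map_shift, shift_shift]
    congr 4
    funext i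
    have hxi : (x i : ℚ) ≠ 0 := by exact_mod_cast hx i
    simp only [Pi.add_apply]
    push_cast
    field_simp
    ring
  exact_mod_cast this

end Rid

namespace Rid
open MvPolynomial

/-- final numeric contradiction -/
lemma numeric (ε l μ s n G δ κ : ℝ) (hε : 0 < ε) (hε1 : ε ≤ 1) (hl0 : 0 ≤ l) (hl : l ≤ 2) (hμ0 : 0 ≤ μ) (hμ : μ ≤ 10)
    (hs : s ≤ l - ε / 2) (hs0 : 0 ≤ s) (hn : 1 ≤ n) (hG : 40 / ε ≤ G) (hδ : δ = ε / 1000) (hκ : κ = ε / 100)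
    (h : μ * (n / 2 - n * δ) + l * (n / 2 - (n + 1) * δ) ≤ 4 * n / G + (n / 2 + (n + 1) * δ) * (s + μ + 3 * κ)) :
    False := by
  have hG0 : 0 < G := lt_of_lt_of_le (by positivity) hG
  have h4 : 4 * n / G ≤ n * (ε / 10) := by
    rw [div_le_iff₀ hG0]
    rw [div_le_iff₀ hε] at hG
    nlinarith
  have hδ0 : 0 < δ := by rw [hδ]; positivity
  have h1 : (n / 2 + (n + 1) * δ) * (s + μ + 3 * κ) ≤ (n / 2 + 2 * n * δ) * (l - ε / 2 + μ + 3 * κ) := by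
    apply mul_le_mul
    · nlinarith
    · linarith
    · rw [hκ]; positivity
    · positivity
  have h2 : l * (n / 2 - 2 * n * δ) ≤ l * (n / 2 - (n + 1) * δ) := by
    apply mul_le_mul_of_nonneg_left _ hl0
    nlinarith
  have h3 : n * (μ * (1 / 2 - δ) + l * (1 / 2 - 2 * δ)) ≤ n * (ε / 10 + (1 / 2 + 2 * δ) * (l - ε / 2 + μ + 3 * κ)) := by
    nlinarith
  have h5 := le_of_mul_le_mul_left h3 (by linarith)
  subst hδ hκ
  nlinarith [mul_nonneg hε.le hl0, mul_nonneg hε.le hμ0, mul_le_mul_of_nonneg_left hl hε.le, mul_le_mul_of_nonneg_left hμ hε.le]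

set_option maxHeartbeats 2000000 in
lemma core (ε : ℝ) (hε : 0 < ε) (hε1 : ε ≤ 1) : ∃ n G : ℕ, 1 ≤ G ∧
    ∀ (α β μ : ℝ), 0 ≤ α → 0 ≤ β → 0 ≤ μ → μ ≤ 10 → α + β ≤ Real.logb 2 3 - ε / 2 →
    ∀ (K A m : Fin n → ℕ) (B : Fin n → ℤ), (∀ i, G ≤ K i) → (∀ i j, i < j → G * K j ≤ K i) →
    (∀ i, 1 ≤ A i) → (∀ i, B i ≠ 0) → (∀ i, (3 : ℤ) ^ K i ∣ A i * 2 ^ m i + B i) →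
    (∀ i, 2 ^ K i ≤ ((B i : ℚ) / (A i * 2 ^ m i : ℕ)).den ^ 2) →
    (∀ i, (A i : ℝ) ≤ 2 ^ ((α + ε / 100) * K i)) → (∀ i, |(B i : ℝ)| ≤ 2 ^ ((β + ε / 100) * K i)) →
    (∀ i, μ * K i ≤ m i) → (∀ i, (m i : ℝ) ≤ (μ + ε / 100) * K i) → False := by
  classical
  set δ := ε / 1000 with hδ
  have hδ0 : 0 < δ := by positivity
  have hδ1 : δ ≤ 1 := by rw [hδ]; linarith
  have hδ2 : δ < 1 / 2 := by rw [hδ]; linarith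
  obtain ⟨n, hn⟩ : ∃ n : ℕ, 4 / δ ^ 2 ≤ n := exists_nat_ge _
  have hn0 : (0 : ℝ) < n := lt_of_lt_of_le (by positivity) hn
  have hn1 : (1 : ℝ) ≤ n := by exact_mod_cast (by exact_mod_cast hn0 : 0 < n)
  obtain ⟨ω, hω, G₀, hG₀, HR⟩ := RL_all n δ hδ0 hδ1
  obtain ⟨G, hG⟩ : ∃ G : ℕ, max (G₀ : ℝ) (max (3 * n / ω) (40 / ε)) ≤ G := exists_nat_ge _
  have hGa : G₀ ≤ G := by exact_mod_cast (le_max_left _ _).trans hG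
  have hGb : 3 * n / ω ≤ G := ((le_max_left _ _).trans (le_max_right _ _)).trans hG
  have hGc : 40 / ε ≤ G := ((le_max_right _ _).trans (le_max_right _ _)).trans hG
  have hG1 : 1 ≤ G := hG₀.trans hGa
  have hG0 : (0 : ℝ) < G := by exact_mod_cast hG1
  refine ⟨n, G, hG1, ?_⟩
  intro α β μ hα hβ hμ hμ10 hαβ K A m B hKG hKK hA1 hB0 hdvd hden hAle hBle hmge hmle
  have hK0 : ∀ i, 0 < K i := fun i => lt_of_lt_of_le hG1 (hKG i)
  have hKR : ∀ i, (0 : ℝ) < K i := fun i => by exact_mod_cast hK0 i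
  set D : ℕ := ∏ i, K i with hD
  let d : Fin n → ℕ := fun i => ∏ j ∈ Finset.univ.erase i, K j
  have hdK : ∀ i, d i * K i = D := fun i => Finset.prod_erase_mul _ _ (Finset.mem_univ i)
  have hd1 : ∀ i, 1 ≤ d i := fun i => Finset.prod_pos fun j _ => hK0 j
  have hD0 : 0 < D := Finset.prod_pos fun j _ => hK0 j
  have hDR : (0 : ℝ) < D := by exact_mod_cast hD0
  have hdKR : ∀ i, (d i : ℝ) * K i = D := fun i => by exact_mod_cast hdK i
  have hd0 : ∀ i, (0 : ℝ) < d i := fun i => by exact_mod_cast hd1 i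
  obtain ⟨P, hP0, hPs, hQs, hPl⟩ := aux d hd1 δ hδ0 hδ2 hn
  have hsd : ((∑ i, d i : ℕ) : ℝ) ≤ n * D / G := by
    push_cast
    calc ∑ i, (d i : ℝ) ≤ ∑ i : Fin n, (D : ℝ) / G := by
          apply Finset.sum_le_sum
          intro i _
          rw [le_div_iff₀ hG0, ← hdKR i]
          apply mul_le_mul_of_nonneg_left _ (hd0 i).le
          exact_mod_cast hKG i
      _ = _ := by simp; ring
  have hdegP : ∀ i, degreeOf i P ≤ d i := fun i => degreeOf_le_iff.2 fun e he => (hPs e he).1 i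
  let x : Fin n → ℤ := fun i => A i * 2 ^ m i
  have hx0 : ∀ i, x i ≠ 0 := fun i => by
    have : (A i : ℤ) ≠ 0 := by have := hA1 i; omega
    simp only [x]; positivity
  -- the Roth lemma
  obtain ⟨I, hI, hIw⟩ := HR K (fun i => hGa.trans (hKG i))
    (fun i j hij => (Nat.mul_le_mul_right _ hGa).trans (hKK i j hij))
    (fun i => (B i : ℚ) / (x i : ℚ)) (fun i => by
      have := hden i
      simpa [x] using this) D hDR P hP0
    (fun i => by
      rw [← hdKR i]
      exact mul_le_mul_of_nonneg_right (by exact_mod_cast hdegP i) (hKR i).le)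
    (by
      calc (l1 P : ℝ) ≤ (8 : ℝ) ^ (∑ i, d i) := by exact_mod_cast hPl
        _ = (2 : ℝ) ^ ((3 : ℝ) * (∑ i, d i : ℕ)) := by
          rw [Real.rpow_mul (by norm_num), Real.rpow_natCast]; norm_num
        _ ≤ _ := by
          apply Real.rpow_le_rpow_of_exponent_le (by norm_num)
          rw [div_le_iff₀ hω] at hGb
          calc (3 : ℝ) * (∑ i, d i : ℕ) ≤ 3 * (n * D / G) := by linarith
            _ = (3 * n) * D / G := by ring
            _ ≤ (G * ω) * D / G := by gcongr
            _ = ω * D := by field_simp)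
  set R := hom (hd I P) d x B with hR
  have hPd : ∀ e ∈ P.support, ∀ i, e i ≤ d i := fun e he => (hPs e he).1
  have hhd : ∀ e ∈ (hd I P).support, ∀ i, e i ≤ d i := fun e he i => by
    have := hPd _ (mem_support_hd he) i
    rw [Finsupp.add_apply] at this; omega
  have hR0 : R ≠ 0 := by
    intro h0
    have h1 := hom_cast (hd I P) d x B hx0 hhd
    rw [← hR, h0, map_hd, ← coeff_shift] at h1
    have h2 : (∏ i, (x i : ℚ) ^ d i) ≠ 0 := Finset.prod_ne_zero_iff.2 fun i _ =>
      pow_ne_zero _ (by exact_mod_cast hx0 i)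
    exact mul_ne_zero h2 hI (by rw [← h1]; simp)
  -- weights
  have hwt : ∀ e : Fin n →₀ ℕ, ∑ i, (e i : ℝ) * K i = D * (∑ i, ((e i : ℝ) / d i - 1 / 2)) + n * D / 2 := by
    intro e
    have : ∀ i, (e i : ℝ) * K i = D * ((e i : ℝ) / d i - 1 / 2) + D / 2 := by
      intro i
      rw [← hdKR i]
      have := (hd0 i).ne'
      field_simp
      ring
    simp only [this, Finset.sum_add_distrib, ← Finset.mul_sum]
    simp; ring
  have hwtI : ∀ e : Fin n →₀ ℕ, ∑ i, ((e + I) i : ℝ) * K i = ∑ i, (e i : ℝ) * K i + ∑ i, (I i : ℝ) * K i := by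
    intro e
    simp [add_mul, Finset.sum_add_distrib]
  have hI0 : 0 ≤ ∑ i, (I i : ℝ) * K i := by positivity
  have hw : ∀ e ∈ (hd I P).support, D * (n / 2 - (n + 1) * δ) ≤ ∑ i, (e i : ℝ) * K i ∧
      ∑ i, (e i : ℝ) * K i ≤ D * (n / 2 + n * δ) := by
    intro e he
    have h1 := abs_le.1 (hPs _ (mem_support_hd he)).2
    have h2 := hwt (e + I)
    rw [hwtI] at h2
    set z := ∑ i, (((e + I) i : ℕ) / (d i : ℝ) - 1 / 2) with hz
    have h3 : D * z ≤ D * (n * δ) := mul_le_mul_of_nonneg_left h1.2 hDR.le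
    have h4 : D * (-(n * δ)) ≤ D * z := mul_le_mul_of_nonneg_left h1.1 hDR.le
    constructor <;> nlinarith
  have hcw : ∀ e ∈ (hd I P).support, ∑ i, ((d i - e i : ℕ) : ℝ) * K i = n * D - ∑ i, (e i : ℝ) * K i := by
    intro e he
    have : ∀ i, ((d i - e i : ℕ) : ℝ) * K i = D - (e i : ℝ) * K i := by
      intro i
      rw [Nat.cast_sub (hhd e he i), sub_mul, hdKR]
    simp only [this, Finset.sum_sub_distrib]
    simp
  -- divisibility by a power of two
  set p2 := ⌈μ * (D * (n / 2 - n * δ))⌉₊ with hp2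
  have h2dvd : (2 : ℤ) ^ p2 ∣ R := by
    apply hom_dvd
    intro e he
    have h1 : p2 ≤ ∑ i, m i * (d i - e i) := by
      rw [hp2, Nat.ceil_le]
      push_cast
      calc μ * (D * (n / 2 - n * δ)) ≤ μ * ∑ i, ((d i - e i : ℕ) : ℝ) * K i := by
            apply mul_le_mul_of_nonneg_left _ hμ
            rw [hcw e he]
            linarith [(hw e he).2]
        _ = ∑ i, μ * K i * ((d i - e i : ℕ) : ℝ) := by
            rw [Finset.mul_sum]; apply Finset.sum_congr rfl; intros; ring
        _ ≤ _ := Finset.sum_le_sum fun i _ => mul_le_mul_of_nonneg_right (hmge i) (Nat.cast_nonneg _)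
    refine (pow_dvd_pow _ h1).trans ?_
    rw [← Finset.prod_pow_eq_pow_sum]
    apply Finset.prod_dvd_prod_of_dvd
    intro i _
    apply Dvd.dvd.mul_left
    rw [pow_mul]
    exact pow_dvd_pow_of_dvd (Dvd.intro_left _ rfl) _
  -- divisibility by a power of three
  set p3 := ⌈D * (n / 2 - (n + 1) * δ)⌉₊ with hp3
  have h3dvd : (3 : ℤ) ^ p3 ∣ R := by
    rw [hR, hom_shift P I d x B hx0 hPd (fun e he => (hQs e he).1)]
    apply hom_dvd
    intro e he
    have h1 : p3 ≤ ∑ i, K i * e i := by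
      rw [hp3, Nat.ceil_le]
      push_cast
      have h1 := (hQs _ (mem_support_hd he)).2
      have h2 := hwt (e + I)
      rw [hwtI] at h2
      set z := ∑ i, (((e + I) i : ℕ) / (d i : ℝ) - 1 / 2) with hz
      have h4 : D * (-(n * δ)) ≤ D * z := mul_le_mul_of_nonneg_left h1 hDR.le
      have h5 : ∑ i, (K i : ℝ) * e i = ∑ i, (e i : ℝ) * K i :=
        Finset.sum_congr rfl fun i _ => mul_comm _ _
      rw [h5]
      nlinarith
    refine (pow_dvd_pow _ h1).trans ?_
    rw [← Finset.prod_pow_eq_pow_sum]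
    apply Finset.prod_dvd_prod_of_dvd
    intro i _
    apply Dvd.dvd.mul_right
    rw [pow_mul]
    exact pow_dvd_pow_of_dvd (hdvd i) _
  have hcop : IsCoprime ((2 : ℤ) ^ p2) ((3 : ℤ) ^ p3) := IsCoprime.pow (by
    rw [Int.isCoprime_iff_gcd_eq_one]; norm_num)
  have hdv := hcop.mul_dvd h2dvd h3dvd
  have hlow : (2 : ℝ) ^ p2 * (3 : ℝ) ^ p3 ≤ |(R : ℝ)| := by
    have := Int.le_of_dvd (abs_pos.2 hR0) ((dvd_abs _ _).2 hdv)
    exact_mod_cast this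
  -- upper bound
  set κ := ε / 100 with hκ
  have hκ0 : 0 < κ := by positivity
  set T : ℝ := (2 : ℝ) ^ (D * (n / 2 + (n + 1) * δ) * (α + β + μ + 3 * κ)) with hT
  have hup : |(R : ℝ)| ≤ l1 (hd I P) * T := by
    apply hom_le
    intro e he
    have hterm : ∀ i, |(B i : ℝ)| ^ e i * |(x i : ℝ)| ^ (d i - e i) ≤
        (2 : ℝ) ^ ((β + κ) * (e i * K i) + (α + μ + 2 * κ) * (((d i - e i : ℕ) : ℝ) * K i)) := by
      intro i
      have hxi : |(x i : ℝ)| ≤ 2 ^ ((α + μ + 2 * κ) * K i) := by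
        have h1 : |(x i : ℝ)| = (A i : ℝ) * 2 ^ m i := by
          simp only [x]; push_cast; rw [abs_of_nonneg (by positivity)]
        rw [h1]
        calc (A i : ℝ) * 2 ^ m i ≤ 2 ^ ((α + κ) * K i) * 2 ^ ((μ + κ) * K i) := by
              apply mul_le_mul (hAle i) _ (by positivity) (by positivity)
              rw [← Real.rpow_natCast]
              exact Real.rpow_le_rpow_of_exponent_le (by norm_num) (hmle i)
          _ = _ := by rw [← Real.rpow_add (by norm_num)]; ring_nf
      calc |(B i : ℝ)| ^ e i * |(x i : ℝ)| ^ (d i - e i) ≤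
          (2 ^ ((β + κ) * K i)) ^ e i * (2 ^ ((α + μ + 2 * κ) * K i)) ^ (d i - e i) := by
            gcongr
            exact hBle i
        _ = _ := by
          rw [← Real.rpow_natCast, ← Real.rpow_natCast, ← Real.rpow_mul (by norm_num), ← Real.rpow_mul (by norm_num),
            ← Real.rpow_add (by norm_num)]
          ring_nf
    calc _ ≤ ∏ i, (2 : ℝ) ^ ((β + κ) * (e i * K i) + (α + μ + 2 * κ) * (((d i - e i : ℕ) : ℝ) * K i)) :=
          Finset.prod_le_prod (fun i _ => by positivity) (fun i _ => hterm i)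
      _ = (2 : ℝ) ^ (∑ i, ((β + κ) * (e i * K i) + (α + μ + 2 * κ) * (((d i - e i : ℕ) : ℝ) * K i))) := by
          rw [Real.rpow_sum_of_pos (by norm_num)]
      _ ≤ T := by
          apply Real.rpow_le_rpow_of_exponent_le (by norm_num)
          rw [Finset.sum_add_distrib, ← Finset.mul_sum, ← Finset.mul_sum, hcw e he]
          obtain ⟨h1, h2⟩ := hw e he
          set S := ∑ i, (e i : ℝ) * K i
          have h3 : S ≤ D * (n / 2 + (n + 1) * δ) := by nlinarith
          have h4 : n * D - S ≤ D * (n / 2 + (n + 1) * δ) := by nlinarith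
          have h5 := mul_le_mul_of_nonneg_left h3 (by positivity : 0 ≤ β + κ)
          have h6 := mul_le_mul_of_nonneg_left h4 (by positivity : 0 ≤ α + μ + 2 * κ)
          nlinarith
  have hl1h : (l1 (hd I P) : ℝ) ≤ 2 ^ ((4 : ℝ) * (n * D / G)) := by
    have h1 : l1 (hd I P) ≤ 2 ^ (∑ i, d i) * 8 ^ (∑ i, d i) :=
      (l1_hd_le I P).trans (Nat.mul_le_mul (Nat.pow_le_pow_right (by norm_num)
        (Finset.sum_le_sum fun i _ => hdegP i)) hPl)
    rw [← mul_pow] at h1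
    calc (l1 (hd I P) : ℝ) ≤ (16 : ℝ) ^ (∑ i, d i) := by exact_mod_cast h1
      _ = (2 : ℝ) ^ ((4 : ℝ) * (∑ i, d i : ℕ)) := by
          rw [Real.rpow_mul (by norm_num), Real.rpow_natCast]; norm_num
      _ ≤ _ := by
          apply Real.rpow_le_rpow_of_exponent_le (by norm_num)
          linarith
  set l := Real.logb 2 3 with hl
  have h3l : (2 : ℝ) ^ l = 3 := Real.rpow_logb (by norm_num) (by norm_num) (by norm_num)
  have hl0 : 0 ≤ l := Real.logb_nonneg (by norm_num) (by norm_num)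
  have hl2 : l ≤ 2 := by
    rw [hl, Real.logb_le_iff_le_rpow (by norm_num) (by norm_num)]; norm_num
  have hfin : (2 : ℝ) ^ (μ * (D * (n / 2 - n * δ)) + l * (D * (n / 2 - (n + 1) * δ))) ≤
      2 ^ (4 * (n * D / G) + D * (n / 2 + (n + 1) * δ) * (α + β + μ + 3 * κ)) := by
    calc (2 : ℝ) ^ (μ * (D * (n / 2 - n * δ)) + l * (D * (n / 2 - (n + 1) * δ))) =
        2 ^ (μ * (D * (n / 2 - n * δ))) * 3 ^ (D * (n / 2 - (n + 1) * δ)) := by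
          rw [Real.rpow_add (by norm_num), Real.rpow_mul (by norm_num) l, h3l]
      _ ≤ (2 : ℝ) ^ p2 * (3 : ℝ) ^ p3 := by
          rw [← Real.rpow_natCast, ← Real.rpow_natCast]
          apply mul_le_mul _ _ (by positivity) (by positivity)
          · exact Real.rpow_le_rpow_of_exponent_le (by norm_num) (Nat.le_ceil _)
          · exact Real.rpow_le_rpow_of_exponent_le (by norm_num) (Nat.le_ceil _)
      _ ≤ |(R : ℝ)| := hlow
      _ ≤ l1 (hd I P) * T := hup
      _ ≤ 2 ^ ((4 : ℝ) * (n * D / G)) * T := by gcongr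
      _ = _ := by rw [hT, ← Real.rpow_add (by norm_num)]
  rw [Real.rpow_le_rpow_left_iff (by norm_num)] at hfin
  refine numeric ε l μ (α + β) n G δ κ hε hε1 hl0 hl2 hμ hμ10 hαβ (by positivity) hn1 hGc rfl rfl ?_
  refine le_of_mul_le_mul_left (a := (D : ℝ)) ?_ hDR
  calc _ = μ * (D * (n / 2 - n * δ)) + l * (D * (n / 2 - (n + 1) * δ)) := by ring
    _ ≤ _ := hfin
    _ = _ := by ring

end Rid

namespace Rid
open MvPolynomial

/-- colour-restricted solutions -/
def Sol (ε α β μ : ℝ) (K : ℕ) : Prop := ∃ (A m : ℕ) (B : ℤ), 1 ≤ A ∧ B ≠ 0 ∧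
  (3 : ℤ) ^ K ∣ A * 2 ^ m + B ∧ 2 ^ K ≤ ((B : ℚ) / (A * 2 ^ m : ℕ)).den ^ 2 ∧
  (A : ℝ) ≤ 2 ^ ((α + ε / 100) * K) ∧ |(B : ℝ)| ≤ 2 ^ ((β + ε / 100) * K) ∧
  μ * K ≤ m ∧ (m : ℝ) ≤ (μ + ε / 100) * K ∧ α + β ≤ Real.logb 2 3 - ε / 2 ∧ μ ≤ 10

lemma sol_eventually (ε α β μ : ℝ) (hε : 0 < ε) (hε1 : ε ≤ 1) (hα : 0 ≤ α) (hβ : 0 ≤ β) (hμ : 0 ≤ μ) :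
    ∃ K₀ : ℕ, ∀ K, K₀ ≤ K → ¬ Sol ε α β μ K := by
  by_contra! h
  obtain ⟨n, G, hG, H⟩ := core ε hε hε1
  choose f hf hs using h
  let u : ℕ → ℕ := fun k => Nat.rec (f G) (fun _ v => f (G * v)) k
  have hu0 : u 0 = f G := rfl
  have hus : ∀ k, u (k + 1) = f (G * u k) := fun k => rfl
  have hu1 : ∀ k, G * u k ≤ u (k + 1) := fun k => by rw [hus]; exact hf _
  have hmono : Monotone u := monotone_nat_of_le_succ fun k =>
    le_trans (Nat.le_mul_of_pos_left _ hG) (hu1 k)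
  have huG : ∀ k, G ≤ u k := fun k => le_trans (by rw [hu0]; exact hf G) (hmono (Nat.zero_le k))
  have hsol : ∀ k, Sol ε α β μ (u k) := by
    intro k
    cases k with
    | zero => rw [hu0]; exact hs _
    | succ k => rw [hus]; exact hs _
  choose A m B h1 h2 h3 h4 h5 h6 h7 h8 h9 h10 using hsol
  let v : Fin n → ℕ := fun i => n - 1 - i
  refine H α β μ hα hβ hμ (h10 0) (h9 0) (fun i => u (v i)) (fun i => A (v i)) (fun i => m (v i))
    (fun i => B (v i)) (fun i => huG _) ?_ (fun i => h1 _) (fun i => h2 _) (fun i => h3 _) (fun i => h4 _)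
    (fun i => h5 _) (fun i => h6 _) (fun i => h7 _) (fun i => h8 _)
  intro i j hij
  have hle : v j + 1 ≤ v i := by
    have : (i : ℕ) < j := hij
    have := j.2
    simp only [v]
    omega
  exact le_trans (hu1 (v j)) (hmono hle)

lemma floor_bounds (κ K a : ℝ) (hκ : 0 < κ) (hK : 0 < K) (ha : 0 ≤ a) :
    κ * (⌊a / (κ * K)⌋₊ : ℝ) * K ≤ a ∧ a ≤ (κ * (⌊a / (κ * K)⌋₊ : ℝ) + κ) * K := by
  have hp : 0 < κ * K := by positivity
  have h1 := Nat.floor_le (a := a / (κ * K)) (by positivity)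
  have h2 := (Nat.lt_floor_add_one (a / (κ * K))).le
  rw [le_div_iff₀ hp] at h1
  rw [div_le_iff₀ hp] at h2
  constructor <;> nlinarith

lemma nosol (ε : ℝ) (hε : 0 < ε) (hε1 : ε ≤ 1) : ∃ K₀ : ℕ, ∀ K, K₀ ≤ K → ∀ (A m : ℕ) (B : ℤ), 1 ≤ A → B ≠ 0 →
    (3 : ℤ) ^ K ∣ A * 2 ^ m + B → 2 ^ K ≤ ((B : ℚ) / (A * 2 ^ m : ℕ)).den ^ 2 → m ≤ 10 * K →
    (A : ℝ) * |(B : ℝ)| ≤ 2 ^ ((Real.logb 2 3 - ε / 2) * K) → False := by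
  set κ := ε / 100 with hκ
  have hκ0 : 0 < κ := by positivity
  set N := ⌊10 / κ⌋₊ + 1 with hN
  have H : ∀ c : Fin N × Fin N × Fin N, ∀ᶠ K in Filter.atTop,
      ¬ Sol ε (κ * (c.1 : ℕ)) (κ * (c.2.1 : ℕ)) (κ * (c.2.2 : ℕ)) K := by
    intro c
    rw [Filter.eventually_atTop]
    exact sol_eventually ε _ _ _ hε hε1 (by positivity) (by positivity) (by positivity)
  rw [← Filter.eventually_all, Filter.eventually_atTop] at H
  obtain ⟨K₀, hK₀⟩ := H
  refine ⟨max K₀ 1, ?_⟩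
  intro K hK A m B hA hB hdvd hden hm hAB
  have hK0 : (0 : ℝ) < K := by exact_mod_cast (le_max_right _ _).trans hK
  set l := Real.logb 2 3 with hl
  have hl2 : l ≤ 2 := by
    rw [hl, Real.logb_le_iff_le_rpow (by norm_num) (by norm_num)]; norm_num
  have hAR : (1 : ℝ) ≤ A := by exact_mod_cast hA
  have hBR : (1 : ℝ) ≤ |(B : ℝ)| := by exact_mod_cast Int.one_le_abs hB
  set a := Real.logb 2 A with ha
  set b := Real.logb 2 |(B : ℝ)| with hb
  have ha0 : 0 ≤ a := Real.logb_nonneg (by norm_num) hAR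
  have hb0 : 0 ≤ b := Real.logb_nonneg (by norm_num) hBR
  have h2a : (2 : ℝ) ^ a = A := Real.rpow_logb (by norm_num) (by norm_num) (by linarith)
  have h2b : (2 : ℝ) ^ b = |(B : ℝ)| := Real.rpow_logb (by norm_num) (by norm_num) (by linarith)
  have hab : a + b ≤ (l - ε / 2) * K := by
    rw [← h2a, ← h2b, ← Real.rpow_add (by norm_num), Real.rpow_le_rpow_left_iff (by norm_num)] at hAB
    exact hAB
  have hab2 : a + b ≤ 10 * K := by nlinarith
  have hmR : (m : ℝ) ≤ 10 * K := by exact_mod_cast hm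
  have hfl : ∀ z : ℝ, z ≤ 10 * K → ⌊z / (κ * K)⌋₊ < N := by
    intro z hz
    rw [hN, Nat.lt_succ_iff]
    apply Nat.floor_le_floor
    rw [div_le_div_iff₀ (by positivity) hκ0]
    nlinarith
  obtain ⟨ha1, ha2⟩ := floor_bounds κ K a hκ0 hK0 ha0
  obtain ⟨hb1, hb2⟩ := floor_bounds κ K b hκ0 hK0 hb0
  obtain ⟨hm1, hm2⟩ := floor_bounds κ K m hκ0 hK0 (Nat.cast_nonneg _)
  refine hK₀ K ((le_max_left _ _).trans hK)
    (⟨⌊a / (κ * K)⌋₊, hfl a (by linarith)⟩, ⟨⌊b / (κ * K)⌋₊, hfl b (by linarith)⟩, ⟨⌊m / (κ * K)⌋₊, hfl m hmR⟩)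
    ⟨A, m, B, hA, hB, hdvd, hden, ?_, ?_, hm1, hm2, ?_, ?_⟩
  · rw [← h2a]; exact Real.rpow_le_rpow_of_exponent_le (by norm_num) ha2
  · rw [← h2b]; exact Real.rpow_le_rpow_of_exponent_le (by norm_num) hb2
  · refine le_of_mul_le_mul_right (a := (K : ℝ)) ?_ hK0
    simp only
    nlinarith
  · refine le_of_mul_le_mul_right (a := (K : ℝ)) ?_ hK0
    simp only
    linarith

end Rid

namespace Rid

lemma den_bound (A m K : ℕ) (B : ℤ) (hA : 1 ≤ A) (hB : B ≠ 0) (hdvd : (3 : ℤ) ^ K ∣ A * 2 ^ m + B)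
    (hne : (A : ℤ) * 2 ^ m + B ≠ 0) (hle : |B| ≤ A * 2 ^ m) (hAB : A * |B| ≤ 3 ^ K) (hK : 4 ≤ K) :
    2 ^ K ≤ ((B : ℚ) / (A * 2 ^ m : ℕ)).den ^ 2 := by
  have hx0 : ((A * 2 ^ m : ℕ) : ℤ) ≠ 0 := by positivity
  set q : ℚ := (B : ℚ) / (A * 2 ^ m : ℕ) with hq
  obtain ⟨c, hc1, hc2⟩ := Rat.num_den_mk (q := q) (n := B) (d := ((A * 2 ^ m : ℕ) : ℤ)) hx0 (by
    rw [hq, Rat.divInt_eq_div]; push_cast; rfl)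
  have hc0 : c ≠ 0 := by rintro rfl; simp at hc1; exact hB hc1
  push_cast at hc2
  have hsum : (A : ℤ) * 2 ^ m + B = c * (q.num + q.den) := by rw [hc2, hc1]; ring
  obtain ⟨s, c', hc', hcs⟩ : ∃ s c', ¬ (3 : ℤ) ∣ c' ∧ c = 3 ^ s * c' := by
    have hfin : FiniteMultiplicity (3 : ℤ) c := Int.finiteMultiplicity_iff.2 ⟨by norm_num, hc0⟩
    obtain ⟨c', h1, h2⟩ := hfin.exists_eq_pow_mul_and_not_dvd
    exact ⟨_, c', h2, h1⟩
  have hcop3 : IsCoprime ((3 : ℤ)) c' := (Int.prime_three.coprime_iff_not_dvd).2 hc'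
  have hsA : (3 : ℤ) ^ s ∣ A := by
    have h1 : (3 : ℤ) ^ s ∣ A * 2 ^ m := by rw [hc2, hcs]; exact ⟨c' * q.den, by ring⟩
    have h2 : IsCoprime ((3 : ℤ) ^ s) (2 ^ m) := IsCoprime.pow (by
      rw [Int.isCoprime_iff_gcd_eq_one]; norm_num)
    exact h2.dvd_of_dvd_mul_right h1
  have hsB : (3 : ℤ) ^ s ∣ |B| := by
    rw [dvd_abs, hc1, hcs]; exact ⟨c' * q.num, by ring⟩
  have h2s : 2 * s ≤ K := by
    have h1 : (3 : ℤ) ^ (2 * s) ≤ A * |B| := by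
      apply Int.le_of_dvd (by positivity)
      rw [two_mul, pow_add]
      exact mul_dvd_mul hsA hsB
    have h2 : (3 : ℤ) ^ (2 * s) ≤ 3 ^ K := h1.trans hAB
    exact (pow_le_pow_iff_right₀ (by norm_num)).1 h2
  have hd : (3 : ℤ) ^ (K - s) ∣ q.num + q.den := by
    rw [hsum, hcs] at hdvd
    have h1 : (3 : ℤ) ^ s * 3 ^ (K - s) ∣ 3 ^ s * (c' * (q.num + q.den)) := by
      rw [← pow_add, show s + (K - s) = K by omega, ← mul_assoc]; exact hdvd
    have h2 := Int.dvd_of_mul_dvd_mul_left (by positivity) h1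
    exact (IsCoprime.pow_left hcop3).dvd_of_dvd_mul_left h2
  have hnd : q.num + q.den ≠ 0 := by
    intro h; rw [hsum, h, mul_zero] at hne; exact hne rfl
  have hnum : |q.num| ≤ q.den := by
    rw [hc1, hc2, abs_mul] at hle
    have h1 : c * q.den ≤ |c| * q.den := mul_le_mul_of_nonneg_right (le_abs_self c) (by positivity)
    exact le_of_mul_le_mul_left (hle.trans h1) (abs_pos.2 hc0)
  have h3 : (3 : ℤ) ^ (K - s) ≤ 2 * q.den := by
    have h1 := Int.le_of_dvd (abs_pos.2 hnd) ((dvd_abs _ _).2 hd)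
    have h2 := abs_add_le q.num (q.den : ℤ)
    rw [abs_of_nonneg (by positivity : (0 : ℤ) ≤ q.den)] at h2
    linarith
  have h4 : 3 ^ (K - s) ≤ 2 * q.den := by exact_mod_cast h3
  have h5 : 3 ^ K ≤ 4 * q.den ^ 2 := by
    calc 3 ^ K ≤ 3 ^ ((K - s) * 2) := Nat.pow_le_pow_right (by norm_num) (by omega)
      _ = (3 ^ (K - s)) ^ 2 := pow_mul _ _ _
      _ ≤ (2 * q.den) ^ 2 := Nat.pow_le_pow_left h4 2
      _ = _ := by ring
  have h6 : 4 * 2 ^ K ≤ 3 ^ K := by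
    obtain ⟨r, rfl⟩ := Nat.exists_eq_add_of_le hK
    rw [pow_add, pow_add]
    have := Nat.pow_le_pow_left (show 2 ≤ 3 by norm_num) r
    norm_num
    omega
  omega

lemma extract (N l a : ℕ) (hl : 1 ≤ l) (hal : a + l ≤ (Nat.digits 2 N).length)
    (h : ∀ j < l, N.testBit (a + j) = N.testBit a) :
    ∃ (A m : ℕ) (B : ℤ), 1 ≤ A ∧ l ≤ m ∧ (N : ℤ) = A * 2 ^ m + B ∧ |B| ≤ 2 ^ (m - l) ∧ A * 2 ^ m ≤ 2 * N := by
  have hN2 : 2 ^ a ≤ N := by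
    rw [← Nat.lt_digits_length_iff (by norm_num)]; omega
  have hpow : (2 : ℕ) ^ (a + l) = 2 ^ a * 2 ^ l := pow_add _ _ _
  have hdm1 := Nat.div_add_mod N (2 ^ a)
  have hdm2 := Nat.div_add_mod (N / 2 ^ a) (2 ^ l)
  have hlt := Nat.mod_lt N (show 0 < 2 ^ a by positivity)
  have hdd : N / 2 ^ a / 2 ^ l = N / 2 ^ (a + l) := by rw [Nat.div_div_eq_div_mul, hpow]
  rw [hdd] at hdm2
  cases hb : N.testBit a with
  | false =>
    have hmod : N / 2 ^ a % 2 ^ l = 0 := by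
      apply Nat.eq_of_testBit_eq
      intro j
      rw [Nat.testBit_mod_two_pow, Nat.testBit_div_two_pow, Nat.zero_testBit]
      by_cases hj : j < l
      · rw [Nat.add_comm, h j hj, hb]; simp
      · simp [hj]
    have heq : N = N / 2 ^ (a + l) * 2 ^ (a + l) + N % 2 ^ a := by
      rw [hmod] at hdm2
      rw [hpow] at *
      calc N = 2 ^ a * (N / 2 ^ a) + N % 2 ^ a := hdm1.symm
        _ = _ := by rw [← hdm2]; ring
    refine ⟨N / 2 ^ (a + l), a + l, (N % 2 ^ a : ℕ), ?_, by omega, ?_, ?_, ?_⟩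
    · refine Nat.one_le_iff_ne_zero.2 (fun h0 => ?_)
      rw [h0, zero_mul, zero_add] at heq
      exact absurd (hN2.trans heq.le) (not_le.2 hlt)
    · exact_mod_cast heq
    · rw [Nat.add_sub_cancel, abs_of_nonneg (by positivity)]
      exact_mod_cast hlt.le
    · omega
  | true =>
    have hmod : N / 2 ^ a % 2 ^ l = 2 ^ l - 1 := by
      apply Nat.eq_of_testBit_eq
      intro j
      rw [Nat.testBit_mod_two_pow, Nat.testBit_div_two_pow, Nat.testBit_two_pow_sub_one]
      by_cases hj : j < l
      · rw [Nat.add_comm, h j hj, hb]; simp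
      · simp [hj]
    have h1 : 1 ≤ 2 ^ l := Nat.one_le_two_pow
    have heq : N + 2 ^ a = (N / 2 ^ (a + l) + 1) * 2 ^ (a + l) + N % 2 ^ a := by
      rw [hmod] at hdm2
      have h2 : N / 2 ^ a + 1 = 2 ^ l * (N / 2 ^ (a + l)) + 2 ^ l := by omega
      calc N + 2 ^ a = 2 ^ a * (N / 2 ^ a + 1) + N % 2 ^ a := by rw [mul_add]; omega
        _ = _ := by rw [h2, hpow]; ring
    refine ⟨N / 2 ^ (a + l) + 1, a + l, (N % 2 ^ a : ℕ) - (2 : ℤ) ^ a, Nat.le_add_left 1 _, by omega, ?_, ?_, ?_⟩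
    · have : (N : ℤ) + 2 ^ a = ((N / 2 ^ (a + l) + 1 : ℕ) : ℤ) * 2 ^ (a + l) + (N % 2 ^ a : ℕ) := by
        exact_mod_cast heq
      linarith
    · rw [Nat.add_sub_cancel, abs_le]
      have h3 : ((N % 2 ^ a : ℕ) : ℤ) < 2 ^ a := by exact_mod_cast hlt
      have h4 : (0 : ℤ) ≤ (N % 2 ^ a : ℕ) := by positivity
      constructor <;> linarith
    · omega

lemma runLength_mem (N : ℕ) : ∃ a, a + runLength N ≤ (Nat.digits 2 N).length ∧
    ∀ j < runLength N, N.testBit (a + j) = N.testBit a := by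
  have := Nat.sSup_mem (s := {l | ∃ a, a + l ≤ (Nat.digits 2 N).length ∧ ∀ j < l, N.testBit (a + j) = N.testBit a})
    ⟨0, 0, by simp, by simp⟩ ⟨(Nat.digits 2 N).length, by
      rintro l ⟨a, h, _⟩; omega⟩
  exact this

end Rid

theorem stmt9 (η : ℝ) (hη0 : 0 ≤ η) (hη1 : η ≤ 1) :
    ∀ ε > (0:ℝ), ∃ K₀ : ℕ, ∀ K : ℕ, K₀ ≤ K →
      ∀ M : ℕ, 1 ≤ M → (M : ℝ) < 2 ^ (η * K) →
      (runLength (M * 3 ^ K) : ℝ) ≤ η * K + ε * K := by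
  intro ε₀ hε₀
  set ε := min ε₀ 1 with hεd
  have hε : 0 < ε := lt_min hε₀ one_pos
  have hε1 : ε ≤ 1 := min_le_right _ _
  obtain ⟨K₁, hK₁⟩ := Rid.nosol ε hε hε1
  refine ⟨max K₁ (max 4 ⌈2 / ε⌉₊), ?_⟩
  intro K hK M hM hMlt
  have hKa : K₁ ≤ K := (le_max_left _ _).trans hK
  have hK4 : 4 ≤ K := ((le_max_left _ _).trans (le_max_right _ _)).trans hK
  have hKε : 2 / ε ≤ K := (Nat.le_ceil _).trans
    (Nat.cast_le.2 (((le_max_right _ _).trans (le_max_right _ _)).trans hK))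
  have hKR : (0 : ℝ) < K := by positivity
  by_contra! hlt
  set N := M * 3 ^ K with hN
  obtain ⟨a, hal, hrun⟩ := Rid.runLength_mem N
  set l := runLength N with hl
  have hlt2 : η * K + ε * K < l := lt_of_le_of_lt (by
    have : ε ≤ ε₀ := min_le_left _ _
    nlinarith) hlt
  have hl1 : 1 ≤ l := by
    have : (0 : ℝ) < l := lt_of_le_of_lt (by positivity) hlt2
    exact_mod_cast this
  obtain ⟨A, m, B, hA, hlm, hNeq, hBle, hAle⟩ := Rid.extract N l a hl1 hal hrun
  have hM2 : M < 2 ^ K := by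
    have : (M : ℝ) < 2 ^ K := by
      refine lt_of_lt_of_le hMlt ?_
      rw [← Real.rpow_natCast]
      apply Real.rpow_le_rpow_of_exponent_le (by norm_num)
      nlinarith
    exact_mod_cast this
  have hNpos : 0 < N := by positivity
  have hB0 : B ≠ 0 := by
    rintro rfl
    have h1 : N = A * 2 ^ m := by rw [add_zero] at hNeq; exact_mod_cast hNeq
    have h2 : 2 ^ l ∣ M * 3 ^ K := by
      rw [← hN, h1]; exact Dvd.dvd.mul_left (pow_dvd_pow _ hlm) _
    have h3 : 2 ^ l ∣ M := (Nat.Coprime.pow l K (by norm_num : Nat.Coprime 2 3)).dvd_of_dvd_mul_right h2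
    have h4 := Nat.le_of_dvd hM h3
    have h5 : ((2 : ℝ) ^ l) ≤ M := by exact_mod_cast h4
    have h6 := lt_of_le_of_lt h5 hMlt
    rw [← Real.rpow_natCast, Real.rpow_lt_rpow_left_iff (by norm_num)] at h6
    have : 0 < ε * K := by positivity
    linarith
  have hdvd : (3 : ℤ) ^ K ∣ A * 2 ^ m + B := by
    rw [← hNeq, hN]; push_cast; exact Dvd.intro_left _ rfl
  have hm10 : m ≤ 10 * K := by
    have h1 : 2 ^ m ≤ 2 ^ (10 * K) := by
      calc 2 ^ m ≤ A * 2 ^ m := Nat.le_mul_of_pos_left _ hA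
        _ ≤ 2 * (M * 3 ^ K) := hAle
        _ ≤ 2 ^ K * (2 ^ K * 4 ^ K) := by
          apply Nat.mul_le_mul
          · calc 2 = 2 ^ 1 := by norm_num
              _ ≤ 2 ^ K := Nat.pow_le_pow_right (by norm_num) (by omega)
          · exact Nat.mul_le_mul hM2.le (Nat.pow_le_pow_left (by norm_num) K)
        _ = 2 ^ (4 * K) := by
          rw [show 4 = 2 ^ 2 by norm_num, ← pow_mul, ← pow_add, ← pow_add]; congr 1; ring
        _ ≤ _ := Nat.pow_le_pow_right (by norm_num) (by omega)
    exact (Nat.pow_le_pow_iff_right (by norm_num)).1 h1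
  have h3l : (2 : ℝ) ^ (Real.logb 2 3) = 3 := Real.rpow_logb (by norm_num) (by norm_num) (by norm_num)
  have hABl : (A : ℝ) * |(B : ℝ)| * 2 ^ l ≤ 2 * (M * 3 ^ K) := by
    have h1 : |(B : ℝ)| ≤ 2 ^ (m - l) := by exact_mod_cast hBle
    calc (A : ℝ) * |(B : ℝ)| * 2 ^ l ≤ A * 2 ^ (m - l) * 2 ^ l := by gcongr
      _ = A * 2 ^ m := by rw [mul_assoc, ← pow_add, Nat.sub_add_cancel hlm]
      _ ≤ _ := by exact_mod_cast hAle
  have hABr : (A : ℝ) * |(B : ℝ)| ≤ 2 ^ ((Real.logb 2 3 - ε / 2) * K) := by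
    have hp : (0 : ℝ) < 2 ^ (η * K + ε * K) := by positivity
    have h1 : (A : ℝ) * |(B : ℝ)| * 2 ^ (η * K + ε * K) ≤ 2 ^ ((Real.logb 2 3 - ε / 2) * K) * 2 ^ (η * K + ε * K) := by
      calc (A : ℝ) * |(B : ℝ)| * 2 ^ (η * K + ε * K) ≤ A * |(B : ℝ)| * 2 ^ l := by
            apply mul_le_mul_of_nonneg_left _ (by positivity)
            rw [← Real.rpow_natCast]
            exact Real.rpow_le_rpow_of_exponent_le (by norm_num) hlt2.le
        _ ≤ 2 * (M * 3 ^ K) := hABl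
        _ ≤ 2 ^ (ε / 2 * K) * (2 ^ (η * K) * 3 ^ K) := by
            apply mul_le_mul _ _ (by positivity) (by positivity)
            · calc (2 : ℝ) = 2 ^ (1 : ℝ) := by norm_num
                _ ≤ _ := by
                  apply Real.rpow_le_rpow_of_exponent_le (by norm_num)
                  rw [div_le_iff₀ hε] at hKε
                  linarith
            · exact mul_le_mul_of_nonneg_right hMlt.le (by positivity)
        _ = _ := by
          have h3 : (3 : ℝ) ^ K = 2 ^ (Real.logb 2 3 * K) := by
            rw [Real.rpow_mul (by norm_num), h3l, Real.rpow_natCast]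
          rw [h3, ← Real.rpow_add (by norm_num), ← Real.rpow_add (by norm_num), ← Real.rpow_add (by norm_num)]
          ring_nf
    exact le_of_mul_le_mul_right h1 hp
  have hAB3 : (A : ℤ) * |B| ≤ 3 ^ K := by
    have h1 : (A : ℝ) * |(B : ℝ)| ≤ 3 ^ K := by
      refine hABr.trans ?_
      have h3 : (3 : ℝ) ^ K = 2 ^ (Real.logb 2 3 * K) := by
        rw [Real.rpow_mul (by norm_num), h3l, Real.rpow_natCast]
      rw [h3]
      apply Real.rpow_le_rpow_of_exponent_le (by norm_num)
      nlinarith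
    exact_mod_cast h1
  have hBx : |B| ≤ A * 2 ^ m := by
    calc |B| ≤ 2 ^ (m - l) := hBle
      _ ≤ 2 ^ m := pow_le_pow_right₀ (by norm_num) (by omega)
      _ ≤ A * 2 ^ m := le_mul_of_one_le_left (by positivity) (by exact_mod_cast hA)
  refine hK₁ K hKa A m B hA hB0 hdvd ?_ hm10 hABr
  exact Rid.den_bound A m K B hA hB0 hdvd (by rw [← hNeq]; positivity) hBx hAB3 hK4
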